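/- arXiv:1404.5892 — 2 statements merged into one kernel-verified Lean document; each statement's English description precedes it below -/
import Mathlib

section
/- Let Γ be a planar y-monotone poly-line drawing of a simple graph G of height h (all vertices and bends have integer y-coordinates in {1,…,h}). Then there exists a planar straight-line drawing Γ′ of G in which every vertex has the same y-coordinate as in Γ and which has the same left-to-right order in each row as Γ; in particular Γ′ also has height h. -/
open Set

noncomputable section

/-- Points of the plane. -/
abbrev Pt : Type := ℝ × ℝ

/-- The image (set of points) of a polygonal chain given by its list of breakpoints. -/
def chainSet : List Pt → Set Pt
  | [] => ∅
  | [p] => {p}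
  | p :: q :: rest => segment ℝ p q ∪ chainSet (q :: rest)

/-- The bends (interior junction points) of a polygonal chain. -/
def chainBends (l : List Pt) : List Pt := (l.drop 1).dropLast

/-- `S` is the image of a simple (injective) curve from `a` to `b`. -/
def IsSimpleArc (S : Set Pt) (a b : Pt) : Prop :=
  ∃ γ : ℝ → Pt, ContinuousOn γ (Icc (0:ℝ) 1) ∧ InjOn γ (Icc (0:ℝ) 1) ∧
    γ '' Icc (0:ℝ) 1 = S ∧ γ 0 = a ∧ γ 1 = b

/-- A poly-line drawing of a simple graph `G`: an injective placement of the vertices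
together with, for each edge, a simple polygonal arc joining the endpoints. -/
structure PolyDrawing {V : Type} (G : SimpleGraph V) where
  pos : V → Pt
  pos_inj : Function.Injective pos
  arc : Sym2 V → List Pt
  arc_ends : ∀ u v : V, G.Adj u v →
    ((arc s(u, v)).head? = some (pos u) ∧ (arc s(u, v)).getLast? = some (pos v)) ∨
    ((arc s(u, v)).head? = some (pos v) ∧ (arc s(u, v)).getLast? = some (pos u))
  arc_simple : ∀ u v : V, G.Adj u v →
    IsSimpleArc (chainSet (arc s(u, v))) (pos u) (pos v)

namespace PolyDrawing

variable {V : Type} {G : SimpleGraph V}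

/-- The set of points used by the arc of an edge. -/
def edgePts (Γ : PolyDrawing G) (e : Sym2 V) : Set Pt := chainSet (Γ.arc e)

/-- Planarity: no vertex point lies on the arc of a non-incident edge, and arcs of
distinct edges meet only in images of common endpoints. -/
def IsPlanar (Γ : PolyDrawing G) : Prop :=
  (∀ v : V, ∀ e ∈ G.edgeSet, v ∉ e → Γ.pos v ∉ Γ.edgePts e) ∧
  (∀ e ∈ G.edgeSet, ∀ f ∈ G.edgeSet, e ≠ f →
    ∀ p ∈ Γ.edgePts e ∩ Γ.edgePts f, ∃ w : V, w ∈ e ∧ w ∈ f ∧ p = Γ.pos w)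

/-- `y`-monotone: along every edge arc the `y`-coordinate varies weakly monotonically. -/
def IsYMonotone (Γ : PolyDrawing G) : Prop :=
  ∀ e ∈ G.edgeSet,
    List.Chain' (· ≤ ·) ((Γ.arc e).map Prod.snd) ∨
    List.Chain' (· ≥ ·) ((Γ.arc e).map Prod.snd)

/-- The drawing has height `h`: every vertex and every bend has an integer
`y`-coordinate in `{1, …, h}`. -/
def HasHeight (Γ : PolyDrawing G) (h : ℕ) : Prop :=
  (∀ v : V, ∃ k : ℤ, 1 ≤ k ∧ k ≤ (h : ℤ) ∧ (Γ.pos v).2 = (k : ℝ)) ∧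
  (∀ e ∈ G.edgeSet, ∀ p ∈ chainBends (Γ.arc e), ∃ k : ℤ, 1 ≤ k ∧ k ≤ (h : ℤ) ∧ p.2 = (k : ℝ))

/-- All vertices and bends have integer `y`-coordinates. -/
def IntegerY (Γ : PolyDrawing G) : Prop :=
  (∀ v : V, ∃ k : ℤ, (Γ.pos v).2 = (k : ℝ)) ∧
  (∀ e ∈ G.edgeSet, ∀ p ∈ chainBends (Γ.arc e), ∃ k : ℤ, p.2 = (k : ℝ))

/-- The set of all points of the drawing (vertex points and edge arcs). -/
def image (Γ : PolyDrawing G) : Set Pt :=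
  Set.range Γ.pos ∪ ⋃ e ∈ G.edgeSet, Γ.edgePts e

/-- The union of the unbounded connected components of the complement of the drawing. -/
def outerRegion (Γ : PolyDrawing G) : Set Pt :=
  {p | p ∉ Γ.image ∧ ¬ Bornology.IsBounded (connectedComponentIn Γ.imageᶜ p)}

/-- A vertex is inner if its point does not lie on the boundary of the unbounded
connected component of the complement of the drawing. -/
def IsInner (Γ : PolyDrawing G) (v : V) : Prop :=
  Γ.pos v ∉ frontier Γ.outerRegion

/-- Number of incoming edges at `v` (edges whose other endpoint is weakly below `v`;
horizontal edges count as incoming). -/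
def indeg (Γ : PolyDrawing G) (v : V) : ℕ :=
  {w : V | G.Adj v w ∧ (Γ.pos w).2 ≤ (Γ.pos v).2}.ncard

/-- Number of outgoing edges at `v` (edges whose other endpoint is weakly above `v`;
horizontal edges count as outgoing). -/
def outdeg (Γ : PolyDrawing G) (v : V) : ℕ :=
  {w : V | G.Adj v w ∧ (Γ.pos v).2 ≤ (Γ.pos w).2}.ncard

/-- The set of points drawn for an element (vertex or edge) of the graph. -/
def drawSet (Γ : PolyDrawing G) : V ⊕ ↥G.edgeSet → Set Pt
  | Sum.inl v => {Γ.pos v}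
  | Sum.inr e => Γ.edgePts e

end PolyDrawing

/-- A straight-line drawing of a simple graph: an injective placement of the vertices;
each edge is drawn as the closed segment between its endpoints. -/
structure StraightDrawing {V : Type} (G : SimpleGraph V) where
  pos : V → Pt
  pos_inj : Function.Injective pos

namespace StraightDrawing

variable {V : Type} {G : SimpleGraph V}

/-- The closed segment representing an edge. -/
def edgePts (Γ : StraightDrawing G) (e : Sym2 V) : Set Pt :=
  Sym2.lift ⟨fun u v => segment ℝ (Γ.pos u) (Γ.pos v),
    fun u v => segment_symm (𝕜 := ℝ) (Γ.pos u) (Γ.pos v)⟩ e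

/-- Planarity of a straight-line drawing. -/
def IsPlanar (Γ : StraightDrawing G) : Prop :=
  (∀ v : V, ∀ e ∈ G.edgeSet, v ∉ e → Γ.pos v ∉ Γ.edgePts e) ∧
  (∀ e ∈ G.edgeSet, ∀ f ∈ G.edgeSet, e ≠ f →
    ∀ p ∈ Γ.edgePts e ∩ Γ.edgePts f, ∃ w : V, w ∈ e ∧ w ∈ f ∧ p = Γ.pos w)

/-- Every vertex has an integer `y`-coordinate in `{1, …, h}`. -/
def HeightLe (Γ : StraightDrawing G) (h : ℕ) : Prop :=
  ∀ v : V, ∃ k : ℤ, 1 ≤ k ∧ k ≤ (h : ℤ) ∧ (Γ.pos v).2 = (k : ℝ)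

/-- All vertices lie on integer grid points. -/
def IsGrid (Γ : StraightDrawing G) : Prop :=
  ∀ v : V, ∃ p : ℤ × ℤ, Γ.pos v = ((p.1 : ℝ), (p.2 : ℝ))

/-- The set of points drawn for an element (vertex or edge) of the graph. -/
def drawSet (Γ : StraightDrawing G) : V ⊕ ↥G.edgeSet → Set Pt
  | Sum.inl v => {Γ.pos v}
  | Sum.inr e => Γ.edgePts e

end StraightDrawing

/-- The intersection of a set of points with the horizontal line `y = r`,
recorded as a set of `x`-coordinates. -/
def rowSlice (S : Set Pt) (r : ℝ) : Set ℝ := {x : ℝ | (x, r) ∈ S}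

/-- Two drawings (given by the sets drawn for each vertex/edge element) have the same
left-to-right order in each row: for every integer row `r` and elements `a`, `b` both
meeting row `r` in both drawings, the drawing of `a` lies entirely strictly to the left
of that of `b` in one drawing iff it does in the other. -/
def SameRowOrder {α : Type} (D D' : α → Set Pt) : Prop :=
  ∀ r : ℤ, ∀ a b : α,
    (rowSlice (D a) (r : ℝ)).Nonempty → (rowSlice (D b) (r : ℝ)).Nonempty →
    (rowSlice (D' a) (r : ℝ)).Nonempty → (rowSlice (D' b) (r : ℝ)).Nonempty →
    ((∀ x ∈ rowSlice (D a) (r : ℝ), ∀ y ∈ rowSlice (D b) (r : ℝ), x < y) ↔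
     (∀ x ∈ rowSlice (D' a) (r : ℝ), ∀ y ∈ rowSlice (D' b) (r : ℝ), x < y))

/-- A simple graph on `n ≥ 3` vertices is triangulated (maximal planar) if it admits a
planar poly-line drawing and has exactly `3n - 6` edges. -/
def IsTriangulated {V : Type} [Fintype V] (G : SimpleGraph V) : Prop :=
  3 ≤ Fintype.card V ∧ G.edgeSet.ncard = 3 * Fintype.card V - 6 ∧
  ∃ Γ : PolyDrawing G, Γ.IsPlanar

/-- Data of a flat visibility representation: a horizontal segment for every vertex
(given by its `y`-coordinate and left/right `x`-coordinates) and a segment (given by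
its two endpoints) for every edge. -/
structure VisData (V : Type) where
  ly : V → ℝ
  lx : V → ℝ
  rx : V → ℝ
  ep1 : Sym2 V → Pt
  ep2 : Sym2 V → Pt

/-- The horizontal segment of a vertex. -/
def VisData.vseg {V : Type} (D : VisData V) (v : V) : Set Pt :=
  segment ℝ (D.lx v, D.ly v) (D.rx v, D.ly v)

/-- The segment of an edge. -/
def VisData.eseg {V : Type} (D : VisData V) (e : Sym2 V) : Set Pt :=
  segment ℝ (D.ep1 e) (D.ep2 e)

/-- `D` is a planar flat visibility representation of `G` of height `h`. -/
def IsFlatVisRep {V : Type} (G : SimpleGraph V) (D : VisData V) (h : ℕ) : Prop :=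
  (∀ v : V, D.lx v ≤ D.rx v) ∧
  (∀ v : V, ∃ k : ℤ, 1 ≤ k ∧ k ≤ (h : ℤ) ∧ D.ly v = (k : ℝ)) ∧
  (∀ e ∈ G.edgeSet, (D.ep1 e).1 = (D.ep2 e).1 ∨ (D.ep1 e).2 = (D.ep2 e).2) ∧
  (∀ e ∈ G.edgeSet, ∀ p ∈ D.eseg e, 1 ≤ p.2 ∧ p.2 ≤ (h : ℝ)) ∧
  (∀ u v : V, G.Adj u v →
    (D.ep1 s(u, v) ∈ D.vseg u ∧ D.ep2 s(u, v) ∈ D.vseg v) ∨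
    (D.ep1 s(u, v) ∈ D.vseg v ∧ D.ep2 s(u, v) ∈ D.vseg u)) ∧
  (∀ u v : V, u ≠ v → Disjoint (D.vseg u) (D.vseg v)) ∧
  (∀ e ∈ G.edgeSet, ∀ w : V, ∀ p ∈ D.eseg e ∩ D.vseg w, p = D.ep1 e ∨ p = D.ep2 e) ∧
  (∀ e ∈ G.edgeSet, ∀ f ∈ G.edgeSet, e ≠ f → ∀ p ∈ D.eseg e ∩ D.eseg f,
    (p = D.ep1 e ∨ p = D.ep2 e) ∧ (p = D.ep1 f ∨ p = D.ep2 f))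

end

/-- A combinatorial level drawing: elements of type `A` (degenerate ones, with `lo = hi`, playing
the role of vertices) that occupy consecutive rows and are linearly ordered in every row. -/
structure LevelDrawing (V A : Type) where
  row : V → ℤ
  rank : V → ℤ
  lo : A → V
  hi : A → V
  pos : A → ℤ → ℤ
  row_le : ∀ a, row (lo a) ≤ row (hi a)
  pos_lo : ∀ a, pos a (row (lo a)) = rank (lo a)
  pos_hi : ∀ a, pos a (row (hi a)) = rank (hi a)
  endpoint_of_pos_eq : ∀ a b r, a ≠ b → r ∈ Icc (row (lo a)) (row (hi a)) →
    r ∈ Icc (row (lo b)) (row (hi b)) → pos a r = pos b r → r = row (lo a) ∨ r = row (hi a)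
  noncrossing : ∀ a b r, r ∈ Icc (row (lo a)) (row (hi a)) → r + 1 ∈ Icc (row (lo a)) (row (hi a)) →
    r ∈ Icc (row (lo b)) (row (hi b)) → r + 1 ∈ Icc (row (lo b)) (row (hi b)) →
    pos a r < pos b r → pos a (r + 1) ≤ pos b (r + 1)
  eq_of_ends : ∀ a b, row (lo a) < row (hi a) → row (lo a) = row (lo b) → row (hi a) = row (hi b) →
    rank (lo a) = rank (lo b) → rank (hi a) = rank (hi b) → a = b

namespace LevelDrawing

variable {V A : Type} (D : LevelDrawing V A)

/-- The element `a` meets row `r`. -/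
def Meets (a : A) (r : ℤ) : Prop := r ∈ Icc (D.row (D.lo a)) (D.row (D.hi a))

/-- Rows `r` and `s` are neighbouring. -/
def Adjacent (r s : ℤ) : Prop := s = r + 1 ∨ r = s + 1

theorem Adjacent.symm {r s : ℤ} (h : Adjacent r s) : Adjacent s r := Or.symm h

/-- Row `r` is the lowest or the highest row of `a`. -/
def IsEnd (a : A) (r : ℤ) : Prop := r = D.row (D.lo a) ∨ r = D.row (D.hi a)

variable {D}

theorem isEnd_of_pos_eq {a b : A} {r : ℤ} (hab : a ≠ b) (ha : D.Meets a r) (hb : D.Meets b r)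
    (h : D.pos a r = D.pos b r) : D.IsEnd a r := D.endpoint_of_pos_eq a b r hab ha hb h

theorem pos_le_of_adjacent {a b : A} {r s : ℤ} (hrs : Adjacent r s) (ha : D.Meets a r)
    (ha' : D.Meets a s) (hb : D.Meets b r) (hb' : D.Meets b s) (h : D.pos a r < D.pos b r) :
    D.pos a s ≤ D.pos b s := by
  rcases hrs with rfl | rfl
  · exact D.noncrossing a b r ha ha' hb hb' h
  · by_contra! h'
    exact absurd (D.noncrossing b a s hb' hb ha' ha h') (not_le.2 h)

variable [Fintype A]

variable (D) in
open Classical in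
/-- The sum at row `s` of `M` over the elements that meet row `r` to the left of `c`. -/
noncomputable def cutSum (M : A → ℤ → ℝ) (r c s : ℤ) : ℝ :=
  ∑ a, if D.Meets a r ∧ D.pos a r < c then M a s else 0

variable {M : A → ℤ → ℝ}

theorem cutSum_congr {r s c c' : ℤ}
    (hM : ∀ a s, s ≤ D.row (D.lo a) ∨ D.row (D.hi a) ≤ s → M a s = 0)
    (hrs : Adjacent r s)
    (h : ∀ a, D.Meets a r → D.Meets a s → M a s ≠ 0 → (D.pos a r < c ↔ D.pos a s < c')) :
    D.cutSum M s c' s = D.cutSum M r c s := by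
  unfold cutSum
  refine Finset.sum_congr rfl fun a _ => ?_
  by_cases h0 : M a s = 0
  · simp [h0]
  have h1 : ¬ (s ≤ D.row (D.lo a) ∨ D.row (D.hi a) ≤ s) := fun h' => h0 (hM a s h')
  push Not at h1
  have hr : D.Meets a r := by
    rcases hrs with rfl | rfl <;> constructor <;> omega
  have hs : D.Meets a s := ⟨h1.1.le, h1.2.le⟩
  simp [hr, hs, h a hr hs h0]

theorem cutSum_congr_right {r c c' s : ℤ}
    (h : ∀ a, D.Meets a r → M a s ≠ 0 → (D.pos a r < c ↔ D.pos a r < c')) :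
    D.cutSum M r c s = D.cutSum M r c' s := by
  unfold cutSum
  refine Finset.sum_congr rfl fun a _ => ?_
  by_cases h0 : M a s = 0
  · simp [h0]
  by_cases hr : D.Meets a r
  · simp [hr, h a hr h0]
  · simp [hr]

/-- The conditions under which all cut sums are shown to vanish: `M` lives in the interior of
each element and is concave along every cut. -/
structure IsStress (D : LevelDrawing V A) (M : A → ℤ → ℝ) : Prop where
  eq_zero : ∀ a s, s ≤ D.row (D.lo a) ∨ D.row (D.hi a) ≤ s → M a s = 0
  concave : ∀ r c, D.cutSum M r c (r + 1) + D.cutSum M r c (r - 1) ≤ 2 * D.cutSum M r c r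

namespace IsStress

variable (hM : D.IsStress M)
include hM

theorem eq_zero_of_isEnd {a : A} {s : ℤ} (h : D.IsEnd a s) : M a s = 0 :=
  hM.eq_zero a s (h.imp le_of_eq ge_of_eq)

theorem exists_cutSum_eq {r s : ℤ} (hrs : Adjacent r s) (c : ℤ) :
    ∃ c', D.cutSum M s c' s = D.cutSum M r c s ∧
      ∀ b, D.Meets b r → D.Meets b s → c ≤ D.pos b r → c' ≤ D.pos b s ∧
        ∃ a, D.Meets a r ∧ D.Meets a s ∧ c ≤ D.pos a r ∧ c' = D.pos a s := by
  classical
  let B : Finset A := Finset.univ.filter fun a => D.Meets a r ∧ D.Meets a s ∧ c ≤ D.pos a r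
  rcases B.eq_empty_or_nonempty with hB | hB
  · obtain ⟨c', hc'⟩ := (Finset.univ.image fun a => D.pos a s).bddAbove
    have hB' : ∀ b, D.Meets b r → D.Meets b s → ¬ c ≤ D.pos b r := fun b h1 h2 h3 => by
      have : b ∈ B := by simp [B, h1, h2, h3]
      simp [hB] at this
    refine ⟨c' + 1, cutSum_congr hM.eq_zero hrs fun a h1 h2 _ => ?_,
      fun b h1 h2 h3 => absurd h3 (hB' b h1 h2)⟩
    have h3 : D.pos a s ≤ c' := hc' (by simp)
    have h4 := hB' a h1 h2
    omega
  · obtain ⟨e, he, hmin⟩ := B.exists_min_image (fun a => D.pos a s) hB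
    simp only [B, Finset.mem_filter, Finset.mem_univ, true_and] at he hmin
    refine ⟨D.pos e s, cutSum_congr hM.eq_zero hrs fun a h1 h2 h0 => ?_,
      fun b h1 h2 h3 => ⟨hmin b ⟨h1, h2, h3⟩, e, he.1, he.2.1, he.2.2, rfl⟩⟩
    constructor
    · intro h
      have hlt : D.pos a r < D.pos e r := h.trans_le he.2.2
      refine (pos_le_of_adjacent hrs h1 h2 he.1 he.2.1 hlt).lt_of_ne fun heq => h0 ?_
      exact hM.eq_zero_of_isEnd (isEnd_of_pos_eq (by rintro rfl; exact hlt.false) h2 he.2.1 heq)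
    · intro h
      by_contra! h'
      exact absurd (hmin a ⟨h1, h2, h'⟩) (not_le.2 h)

theorem cutSum_eq_zero_of_top {r : ℤ} (h : ∀ a, D.row (D.hi a) ≤ r) (c : ℤ) :
    D.cutSum M r c r = 0 := by
  refine Finset.sum_eq_zero fun a _ => ?_
  simp [hM.eq_zero a r (Or.inr (h a))]

theorem cutSum_eq_zero_of_bot {r : ℤ} (h : ∀ a, r ≤ D.row (D.lo a)) (c : ℤ) :
    D.cutSum M r c r = 0 := by
  refine Finset.sum_eq_zero fun a _ => ?_
  simp [hM.eq_zero a r (Or.inl (h a))]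

omit hM in
theorem exists_top (D : LevelDrawing V A) : ∃ n, ∀ a, D.row (D.hi a) ≤ n := by
  classical
  obtain ⟨c', hc'⟩ := (Finset.univ.image fun a => D.row (D.hi a)).bddAbove
  exact ⟨c', fun a => hc' (by simp)⟩

omit hM in
theorem exists_bot (D : LevelDrawing V A) : ∃ n, ∀ a, n ≤ D.row (D.lo a) := by
  classical
  obtain ⟨c', hc'⟩ := (Finset.univ.image fun a => D.row (D.lo a)).bddBelow
  exact ⟨c', fun a => hc' (by simp)⟩

theorem finite_range_cutSum : (Set.range fun q : ℤ × ℤ => D.cutSum M q.1 q.2 q.1).Finite := by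
  classical
  obtain ⟨n, hn⟩ := exists_top D
  obtain ⟨m, hm⟩ := exists_bot D
  refine ((Finset.finite_toSet (insert 0
    ((Finset.Icc m n ×ˢ (Finset.univ : Finset A).powerset).image fun q => ∑ a ∈ q.2, M a q.1)))).subset ?_
  rintro _ ⟨⟨r, c⟩, rfl⟩
  simp only [Finset.coe_insert, Set.mem_insert_iff]
  by_cases h : r ∈ Finset.Icc m n
  · right
    rw [Finset.mem_coe, Finset.mem_image]
    refine ⟨(r, Finset.univ.filter fun a => D.Meets a r ∧ D.pos a r < c), ?_, ?_⟩
    · simpa using h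
    · simp only [cutSum, Finset.sum_filter]
  · left
    simp only [Finset.mem_Icc, not_and_or, not_le] at h
    rcases h with h | h
    · exact hM.cutSum_eq_zero_of_bot (fun a => h.le.trans (hm a)) c
    · exact hM.cutSum_eq_zero_of_top (fun a => (hn a).trans h.le) c

theorem cutSum_nonneg (r c : ℤ) : 0 ≤ D.cutSum M r c r := by
  obtain ⟨_, ⟨⟨r₀, c₀⟩, rfl⟩, hmin⟩ :=
    Set.exists_min_image _ id hM.finite_range_cutSum ⟨_, ⟨(r, c), rfl⟩⟩
  have hmin' : ∀ r c, D.cutSum M r₀ c₀ r₀ ≤ D.cutSum M r c r := fun r c => hmin _ ⟨(r, c), rfl⟩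
  refine le_trans ?_ (hmin' r c)
  have key : ∀ k : ℕ, ∃ c, D.cutSum M (r₀ + k) c (r₀ + k) = D.cutSum M r₀ c₀ r₀ := by
    intro k
    induction k with
    | zero => exact ⟨c₀, by simp⟩
    | succ k ih =>
      obtain ⟨c, hc⟩ := ih
      obtain ⟨c₁, h₁, -⟩ := hM.exists_cutSum_eq (r := r₀ + k) (s := r₀ + k + 1) (Or.inl rfl) c
      obtain ⟨c₂, h₂, -⟩ := hM.exists_cutSum_eq (r := r₀ + k) (s := r₀ + k - 1)
        (Or.inr (by ring)) c
      refine ⟨c₁, ?_⟩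
      have := hM.concave (r₀ + k) c
      have h3 := hmin' (r₀ + k + 1) c₁
      have h4 := hmin' (r₀ + k - 1) c₂
      push_cast
      rw [← add_assoc]
      linarith
  obtain ⟨n, hn⟩ := exists_top D
  obtain ⟨c, hc⟩ := key (n - r₀).toNat
  rw [← hc, hM.cutSum_eq_zero_of_top]
  intro a
  have := hn a
  omega

theorem cutSum_eq_zero_of_adjacent {r s c : ℤ} (hrs : Adjacent r s) (h : D.cutSum M r c r = 0) :
    D.cutSum M r c s = 0 := by
  have hnn : ∀ s, Adjacent r s → 0 ≤ D.cutSum M r c s := fun s hs => by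
    obtain ⟨c', h', -⟩ := hM.exists_cutSum_eq hs c
    exact h' ▸ hM.cutSum_nonneg _ _
  have h1 := hnn (r + 1) (Or.inl rfl)
  have h2 := hnn (r - 1) (Or.inr (by ring))
  have h3 := hM.concave r c
  rcases hrs with rfl | rfl
  · linarith
  · simp only [add_sub_cancel_right] at *
    linarith

theorem cutSum_eq_zero_of_forall_lt {r c : ℤ} (hc : ∀ a, D.pos a r < c) :
    D.cutSum M r c r = 0 := by
  classical
  obtain ⟨m, hm⟩ := exists_bot D
  rcases le_total r m with h | h
  · exact hM.cutSum_eq_zero_of_bot (fun a => h.trans (hm a)) c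
  induction r, h using Int.leInduction generalizing c with
  | base => exact hM.cutSum_eq_zero_of_bot hm c
  | succ r _ ih =>
    obtain ⟨c', hc'⟩ := (Finset.univ.image fun a => D.pos a r).bddAbove
    have hlt : ∀ a, D.pos a r < c' + 1 := fun a => Int.lt_add_one_iff.2 (hc' (by simp))
    rw [cutSum_congr hM.eq_zero (Or.inl rfl) (c := c' + 1) fun a _ _ _ => by simp [hlt, hc]]
    exact hM.cutSum_eq_zero_of_adjacent (Or.inl rfl) (ih hlt)

omit hM in
/-- In row `r` the cut sums vanish just left of `e` and just right of `e'`, but nowhere between. -/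
structure IsRun (D : LevelDrawing V A) (M : A → ℤ → ℝ) (e e' : A) (r : ℤ) : Prop where
  left_meets : D.Meets e r
  right_meets : D.Meets e' r
  left_not_isEnd : ¬ D.IsEnd e r
  right_not_isEnd : ¬ D.IsEnd e' r
  pos_lt : D.pos e r < D.pos e' r
  left_eq_zero : D.cutSum M r (D.pos e r) r = 0
  right_eq_zero : D.cutSum M r (D.pos e' r + 1) r = 0
  ne_zero : ∀ c, D.pos e r < c → c ≤ D.pos e' r → D.cutSum M r c r ≠ 0

omit hM [Fintype A] in
theorem meets_of_adjacent {a : A} {r s : ℤ} (hrs : Adjacent r s) (h : D.Meets a r)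
    (h' : ¬ D.IsEnd a r) : D.Meets a s := by
  unfold Meets IsEnd at *
  simp only [Set.mem_Icc] at *
  rcases hrs with rfl | rfl <;> omega

omit hM [Fintype A] in
theorem pos_lt_of_adjacent {e a : A} {r s : ℤ} (hrs : Adjacent r s) (he : D.Meets e r)
    (he' : ¬ D.IsEnd e r) (ha : D.Meets a r) (ha' : D.Meets a s) (h : D.pos e s < D.pos a s) :
    D.pos e r < D.pos a r := by
  refine (pos_le_of_adjacent hrs.symm (meets_of_adjacent hrs he he') he ha' ha h).lt_of_ne
    fun heq => he' ?_
  exact isEnd_of_pos_eq (by rintro rfl; exact h.false) he ha heq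

omit hM [Fintype A] in
theorem pos_lt_of_adjacent' {e a : A} {r s : ℤ} (hrs : Adjacent r s) (he : D.Meets e r)
    (he' : ¬ D.IsEnd e r) (ha : D.Meets a r) (ha' : D.Meets a s) (h : D.pos a s < D.pos e s) :
    D.pos a r < D.pos e r := by
  refine (pos_le_of_adjacent hrs.symm ha' ha (meets_of_adjacent hrs he he') he h).lt_of_ne
    fun heq => he' ?_
  exact isEnd_of_pos_eq (by rintro rfl; exact h.false) he ha heq.symm

theorem IsRun.step {e e' : A} {r s : ℤ} (hrs : Adjacent r s) (h : IsRun D M e e' r) :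
    IsRun D M e e' s ∨ D.IsEnd e s ∧ D.IsEnd e' s ∧ D.pos e s = D.pos e' s := by
  have hes := meets_of_adjacent hrs h.left_meets h.left_not_isEnd
  have hes' := meets_of_adjacent hrs h.right_meets h.right_not_isEnd
  have hne : e ≠ e' := by rintro rfl; exact h.pos_lt.false
  have hle := pos_le_of_adjacent hrs h.left_meets hes h.right_meets hes' h.pos_lt
  rcases hle.eq_or_lt with heq | hlt
  · exact Or.inr ⟨isEnd_of_pos_eq hne hes hes' heq, isEnd_of_pos_eq hne.symm hes' hes heq.symm, heq⟩
  left
  have hleft : D.cutSum M s (D.pos e s) s = 0 := by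
    rw [cutSum_congr hM.eq_zero hrs (c := D.pos e r)]
    · exact hM.cutSum_eq_zero_of_adjacent hrs h.left_eq_zero
    · intro a ha ha' h0
      refine ⟨fun hlt => ?_, pos_lt_of_adjacent' hrs h.left_meets h.left_not_isEnd ha ha'⟩
      refine (pos_le_of_adjacent hrs ha ha' h.left_meets hes hlt).lt_of_ne fun heq => h0 ?_
      exact hM.eq_zero_of_isEnd (isEnd_of_pos_eq (by rintro rfl; exact hlt.false) ha' hes heq)
  have hright : D.cutSum M s (D.pos e' s + 1) s = 0 := by
    rw [cutSum_congr hM.eq_zero hrs (c := D.pos e' r + 1)]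
    · exact hM.cutSum_eq_zero_of_adjacent hrs h.right_eq_zero
    · intro a ha ha' h0
      rw [Int.lt_add_one_iff, Int.lt_add_one_iff]
      constructor
      · intro hle
        by_contra! hlt
        exact absurd (pos_lt_of_adjacent hrs h.right_meets h.right_not_isEnd ha ha' hlt)
          (not_lt.2 hle)
      · intro hle
        by_contra! hlt
        have := pos_le_of_adjacent hrs h.right_meets hes' ha ha' hlt
        exact h0 (hM.eq_zero_of_isEnd (isEnd_of_pos_eq (by rintro rfl; exact hlt.false) ha' hes'
          (le_antisymm hle this)))
  have hmid : ∀ c, D.pos e s < c → c ≤ D.pos e' s → D.cutSum M s c s ≠ 0 := by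
    intro c h1 h2 h3
    obtain ⟨c', hc', hB⟩ := hM.exists_cutSum_eq hrs.symm c
    rw [hM.cutSum_eq_zero_of_adjacent hrs.symm h3] at hc'
    obtain ⟨h4, f, hf, hf', h5, rfl⟩ := hB e' hes' h.right_meets h2
    exact h.ne_zero _ (pos_lt_of_adjacent hrs h.left_meets h.left_not_isEnd hf' hf
      (h1.trans_le h5)) h4 hc'
  have hend : ∀ f, D.Meets f s → D.IsEnd f s →
      D.cutSum M s (D.pos f s) s = D.cutSum M s (D.pos f s + 1) s := by
    intro f hf hf'
    refine cutSum_congr_right fun a ha h0 => ?_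
    have : D.pos a s ≠ D.pos f s := fun heq => by
      rcases eq_or_ne a f with rfl | hne
      · exact h0 (hM.eq_zero_of_isEnd hf')
      · exact h0 (hM.eq_zero_of_isEnd (isEnd_of_pos_eq hne ha hf heq))
    omega
  exact {
    left_meets := hes
    right_meets := hes'
    left_not_isEnd := fun hE => hmid (D.pos e s + 1) (by omega) (by omega) (by
      rw [← hend e hes hE, hleft])
    right_not_isEnd := fun hE => hmid (D.pos e' s) (by omega) le_rfl (by
      rw [hend e' hes' hE, hright])
    pos_lt := hlt
    left_eq_zero := hleft
    right_eq_zero := hright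
    ne_zero := hmid }

omit hM in
theorem IsRun.false (hM : D.IsStress M) {e e' : A} {r : ℤ} (h : IsRun D M e e' r) : False := by
  have hr : ∀ {s}, IsRun D M e e' s → D.row (D.lo e) < s ∧ s < D.row (D.hi e) ∧
      D.row (D.lo e') < s ∧ s < D.row (D.hi e') := fun {s} hs => by
    obtain ⟨⟨h1, h2⟩, ⟨h3, h4⟩, h5, h6, -⟩ := hs
    unfold IsEnd at *
    omega
  obtain ⟨u, hu, hmax⟩ := Int.exists_greatest_of_bdd (P := fun s => IsRun D M e e' s)
    ⟨D.row (D.hi e), fun z hz => (hr hz).2.1.le⟩ ⟨r, h⟩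
  obtain ⟨l, hl, hmin⟩ := Int.exists_least_of_bdd (P := fun s => IsRun D M e e' s)
    ⟨D.row (D.lo e), fun z hz => (hr hz).1.le⟩ ⟨r, h⟩
  have hu' := (hu.step hM (s := u + 1) (Or.inl rfl)).resolve_left fun h => by
    have := hmax _ h
    omega
  have hl' := (hl.step hM (s := l - 1) (Or.inr (by ring))).resolve_left fun h => by
    have := hmin _ h
    omega
  have h1 := hr hu
  have h2 := hr hl
  obtain ⟨hu1, hu2, hu3⟩ := hu'
  obtain ⟨hl1, hl2, hl3⟩ := hl'
  have e1 : u + 1 = D.row (D.hi e) := hu1.resolve_left (by omega)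
  have e2 : u + 1 = D.row (D.hi e') := hu2.resolve_left (by omega)
  have e3 : l - 1 = D.row (D.lo e) := hl1.resolve_right (by omega)
  have e4 : l - 1 = D.row (D.lo e') := hl2.resolve_right (by omega)
  have : e = e' := by
    refine D.eq_of_ends e e' (by omega) (by omega) (by omega) ?_ ?_
    · rw [← D.pos_lo, ← D.pos_lo, ← e3, ← e4, hl3]
    · rw [← D.pos_hi, ← D.pos_hi, ← e1, ← e2, hu3]
  subst this
  exact h.pos_lt.false

/-- A concave system of moments on a level drawing without parallel elements vanishes. -/
theorem cutSum_eq_zero (r c : ℤ) : D.cutSum M r c r = 0 := by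
  classical
  by_contra hne
  obtain ⟨b, hb⟩ := (Finset.univ.image fun a => D.pos a r).bddBelow
  obtain ⟨t, ht⟩ := (Finset.univ.image fun a => D.pos a r).bddAbove
  have hb' : ∀ a, b ≤ D.pos a r := fun a => hb (by simp)
  have ht' : ∀ a, D.pos a r < t + 1 := fun a => Int.lt_add_one_iff.2 (ht (by simp))
  have hsmall : ∀ c ≤ b, D.cutSum M r c r = 0 := fun c hc =>
    Finset.sum_eq_zero fun a _ => by simp [not_lt.2 (hc.trans (hb' a))]
  have hlarge : ∀ c, t + 1 ≤ c → D.cutSum M r c r = 0 := fun c hc =>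
    hM.cutSum_eq_zero_of_forall_lt fun a => (ht' a).trans_le hc
  obtain ⟨c₁, ⟨h₁, hc₁⟩, hmax⟩ := Int.exists_greatest_of_bdd
    (P := fun z => D.cutSum M r z r = 0 ∧ z ≤ c) ⟨c, fun z hz => hz.2⟩
    ⟨min b c, hsmall _ (min_le_left _ _), min_le_right _ _⟩
  obtain ⟨c₂, ⟨h₂, hc₂⟩, hmin⟩ := Int.exists_least_of_bdd
    (P := fun z => D.cutSum M r z r = 0 ∧ c ≤ z) ⟨c, fun z hz => hz.2⟩
    ⟨max (t + 1) c, hlarge _ (le_max_left _ _), le_max_right _ _⟩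
  have hc₁' : c₁ ≠ c := by rintro rfl; exact hne h₁
  have hc₂' : c₂ ≠ c := by rintro rfl; exact hne h₂
  have hmid : ∀ z, c₁ < z → z < c₂ → D.cutSum M r z r ≠ 0 := fun z hz hz' h0 => by
    rcases le_total z c with h | h
    · exact absurd (hmax z ⟨h0, h⟩) (not_le.2 hz)
    · exact absurd (hmin z ⟨h0, h⟩) (not_le.2 hz')
  have hjump : ∀ z, D.cutSum M r z r ≠ D.cutSum M r (z + 1) r →
      ∃ a, D.Meets a r ∧ ¬ D.IsEnd a r ∧ D.pos a r = z := fun z hz => by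
    by_contra! hcon
    refine hz (cutSum_congr_right fun a ha h0 => ?_)
    have := hcon a ha fun hE => h0 (hM.eq_zero_of_isEnd hE)
    omega
  obtain ⟨e, he, heE, hpe⟩ := hjump c₁ fun heq => hmid (c₁ + 1) (by omega) (by omega) (heq ▸ h₁)
  obtain ⟨e', he', heE', hpe'⟩ := hjump (c₂ - 1) fun heq => hmid (c₂ - 1) (by omega) (by omega) (by
    rw [heq, sub_add_cancel, h₂])
  exact IsRun.false hM (r := r) (e := e) (e' := e')
    { left_meets := he
      right_meets := he'
      left_not_isEnd := heE
      right_not_isEnd := heE'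
      pos_lt := by omega
      left_eq_zero := by rw [hpe, h₁]
      right_eq_zero := by rw [hpe', sub_add_cancel, h₂]
      ne_zero := fun z hz hz' => hmid z (by omega) (by omega) }

theorem cutSum_adjacent_eq_zero {r s : ℤ} (hrs : Adjacent r s) (c : ℤ) : D.cutSum M r c s = 0 :=
  hM.cutSum_eq_zero_of_adjacent hrs (hM.cutSum_eq_zero r c)

end IsStress

end LevelDrawing
/-- Gordan's theorem of the alternative. -/
theorem exists_forall_pos_or_exists_sum_eq_zero {ι V : Type} [Fintype ι] [Fintype V]
    (a : ι → V → ℝ) :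
    (∃ x : V → ℝ, ∀ i, 0 < ∑ v, a i v * x v) ∨
      ∃ w : ι → ℝ, (∀ i, 0 ≤ w i) ∧ (∃ i, 0 < w i) ∧ ∀ v, ∑ i, w i * a i v = 0 := by
  classical
  by_cases h0 : (0 : V → ℝ) ∈ convexHull ℝ (Set.range a)
  · right
    rw [convexHull_range_eq_exists_affineCombination] at h0
    obtain ⟨s, w, hw, hw1, h⟩ := h0
    rw [s.affineCombination_eq_linear_combination _ _ hw1] at h
    refine ⟨fun i => if i ∈ s then w i else 0, fun i => ?_, ?_, fun v => ?_⟩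
    · dsimp only
      split_ifs with hi
      exacts [hw i hi, le_rfl]
    · obtain ⟨i, hi, hpos⟩ := Finset.exists_lt_of_sum_lt
        (show ∑ i ∈ s, (0 : ℝ) < ∑ i ∈ s, w i by simp [hw1])
      exact ⟨i, by simpa [hi] using hpos⟩
    · simpa [Finset.sum_apply, ite_mul] using congrFun h v
  · left
    obtain ⟨f, u, hu, hf⟩ := geometric_hahn_banach_point_closed (convex_convexHull ℝ _)
      (Set.Finite.isClosed_convexHull (𝕜 := ℝ) (Set.finite_range a)) h0
    refine ⟨fun v => f fun j => if v = j then 1 else 0, fun i => ?_⟩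
    have h1 := hf (a i) (subset_convexHull ℝ _ ⟨i, rfl⟩)
    rw [map_zero] at hu
    have h2 := LinearMap.pi_apply_eq_sum_univ (f : (V → ℝ) →ₗ[ℝ] ℝ) (a i)
    simp only [ContinuousLinearMap.coe_coe, smul_eq_mul] at h2
    rw [← h2]
    exact hu.trans h1

namespace LevelDrawing

section Realization

variable {V A : Type} (D : LevelDrawing V A)

/-- The relative height of row `r` within the element `a`. -/
noncomputable def height (a : A) (r : ℤ) : ℝ :=
  ((r : ℝ) - D.row (D.lo a)) / ((D.row (D.hi a) : ℝ) - D.row (D.lo a))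

/-- The abscissa in row `r` of the element `a`, drawn straight with vertex abscissae `x`. -/
noncomputable def abscissa (x : V → ℝ) (a : A) (r : ℤ) : ℝ :=
  (1 - D.height a r) * x (D.lo a) + D.height a r * x (D.hi a)

open Classical in
/-- The coefficient of the vertex `v` in the abscissa of `a` in row `r`. -/
noncomputable def coeff (a : A) (r : ℤ) (v : V) : ℝ :=
  (1 - D.height a r) * (if D.lo a = v then 1 else 0) +
    D.height a r * (if D.hi a = v then 1 else 0)

/-- The positive part of an integer, as a real number. -/
noncomputable def ramp (z : ℤ) : ℝ := ((max z 0 : ℤ) : ℝ)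

/-- The bending moment at row `s` of the bar `a`, supported at its ends, under a unit load in
row `t`. -/
noncomputable def moment (a : A) (t s : ℤ) : ℝ :=
  ramp (s - t) - (1 - D.height a t) * ramp (s - D.row (D.lo a)) -
    D.height a t * ramp (s - D.row (D.hi a))

theorem sum_coeff_mul [Fintype V] (x : V → ℝ) (a : A) (r : ℤ) :
    ∑ v, D.coeff a r v * x v = D.abscissa x a r := by
  classical
  simp [coeff, abscissa, add_mul, Finset.sum_add_distrib]

theorem ramp_of_nonpos {z : ℤ} (h : z ≤ 0) : ramp z = 0 := by simp [ramp, h]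

theorem ramp_of_nonneg {z : ℤ} (h : 0 ≤ z) : ramp z = z := by simp [ramp, h]

theorem ramp_second_difference (z : ℤ) :
    ramp (z + 1) + ramp (z - 1) - 2 * ramp z = if z = 0 then 1 else 0 := by
  rcases lt_trichotomy z 0 with h | rfl | h
  · rw [ramp_of_nonpos (by omega), ramp_of_nonpos (by omega), ramp_of_nonpos (by omega),
      if_neg h.ne]
    simp
  · simp [ramp]
  · rw [ramp_of_nonneg (by omega), ramp_of_nonneg (by omega), ramp_of_nonneg (by omega),
      if_neg h.ne']
    push_cast
    ring

variable {D}

theorem height_mul {a : A} {t : ℤ} (h : D.Meets a t) :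
    D.height a t * ((D.row (D.hi a) : ℝ) - D.row (D.lo a)) = (t : ℝ) - D.row (D.lo a) := by
  rcases (h.1.trans h.2).eq_or_lt with heq | hlt
  · have : t = D.row (D.lo a) := le_antisymm (heq ▸ h.2) h.1
    simp [← heq, this]
  · have : (D.row (D.lo a) : ℝ) < D.row (D.hi a) := by exact_mod_cast hlt
    unfold height
    field_simp [(sub_pos.2 this).ne']

theorem moment_eq_zero {a : A} {t s : ℤ} (h : D.Meets a t)
    (hs : s ≤ D.row (D.lo a) ∨ D.row (D.hi a) ≤ s) : D.moment a t s = 0 := by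
  have h1 := h.1
  have h2 := h.2
  unfold moment
  rcases hs with hs | hs
  · rw [ramp_of_nonpos (by omega), ramp_of_nonpos (by omega), ramp_of_nonpos (by omega)]
    simp
  · rw [ramp_of_nonneg (by omega), ramp_of_nonneg (by omega), ramp_of_nonneg (by omega)]
    have := height_mul h
    push_cast
    linear_combination this

variable [Fintype V]

open Classical in
theorem cut_second_difference {a : A} {t : ℤ} (h : D.Meets a t) (r c : ℤ) :
    (if D.Meets a r ∧ D.pos a r < c then
      D.moment a t (r + 1) + D.moment a t (r - 1) - 2 * D.moment a t r else 0) =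
    (if r = t ∧ D.pos a t < c then 1 else 0) -
      ∑ v, if D.row v = r ∧ D.rank v < c then D.coeff a t v else 0 := by
  have hsum : (∑ v, if D.row v = r ∧ D.rank v < c then D.coeff a t v else 0) =
      (1 - D.height a t) * (if D.row (D.lo a) = r ∧ D.rank (D.lo a) < c then 1 else 0) +
      D.height a t * (if D.row (D.hi a) = r ∧ D.rank (D.hi a) < c then 1 else 0) := by
    simpa [abscissa] using
      D.sum_coeff_mul (fun v => if D.row v = r ∧ D.rank v < c then (1 : ℝ) else 0) a t
  have hmom : D.moment a t (r + 1) + D.moment a t (r - 1) - 2 * D.moment a t r =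
      (if r = t then 1 else 0) - (1 - D.height a t) * (if D.row (D.lo a) = r then 1 else 0) -
      D.height a t * (if D.row (D.hi a) = r then 1 else 0) := by
    have h1 := ramp_second_difference (r - t)
    have h2 := ramp_second_difference (r - D.row (D.lo a))
    have h3 := ramp_second_difference (r - D.row (D.hi a))
    simp only [sub_eq_zero, eq_comm (a := r) (b := D.row _)] at h1 h2 h3
    rw [← h1, ← h2, ← h3]
    simp only [moment, add_sub_right_comm, sub_right_comm _ (1 : ℤ)]
    ring
  rw [hsum, hmom]
  have hlo : D.row (D.lo a) = r → D.rank (D.lo a) = D.pos a r := fun h => by rw [← h, D.pos_lo]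
  have hhi : D.row (D.hi a) = r → D.rank (D.hi a) = D.pos a r := fun h => by rw [← h, D.pos_hi]
  by_cases hr : D.Meets a r
  · have e0 : (r = t ∧ D.pos a t < c) ↔ (r = t ∧ D.pos a r < c) :=
      and_congr_right fun h => by rw [h]
    have e1 : (D.row (D.lo a) = r ∧ D.rank (D.lo a) < c) ↔ (D.row (D.lo a) = r ∧ D.pos a r < c) :=
      and_congr_right fun h => by rw [hlo h]
    have e2 : (D.row (D.hi a) = r ∧ D.rank (D.hi a) < c) ↔ (D.row (D.hi a) = r ∧ D.pos a r < c) :=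
      and_congr_right fun h => by rw [hhi h]
    simp only [e0, e1, e2]
    by_cases hc : D.pos a r < c
    · simp only [hr, hc, and_self, if_true, and_true]
      ring
    · simp [hc]
  · have n0 : r ≠ t := fun h' => hr (h' ▸ h)
    have n1 : D.row (D.lo a) ≠ r := fun h' => hr (h' ▸ ⟨le_rfl, D.row_le a⟩)
    have n2 : D.row (D.hi a) ≠ r := fun h' => hr (h' ▸ ⟨D.row_le a, le_rfl⟩)
    simp [hr, n0, n1, n2]

/-- Every level drawing without parallel elements can be realized with straight elements. -/
theorem exists_abscissa_lt [Fintype A] (D : LevelDrawing V A) :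
    ∃ x : V → ℝ, ∀ r a b, D.Meets a r → D.Meets b r → D.pos a r < D.pos b r →
      D.abscissa x a r < D.abscissa x b r := by
  classical
  let R : Finset ℤ := Finset.univ.biUnion fun a => Finset.Icc (D.row (D.lo a)) (D.row (D.hi a))
  let ι := {q : R × A × A // D.Meets q.2.1 q.1 ∧ D.Meets q.2.2 q.1 ∧
    D.pos q.2.1 q.1 < D.pos q.2.2 q.1}
  rcases exists_forall_pos_or_exists_sum_eq_zero
    (fun (i : ι) v => D.coeff i.1.2.2 i.1.1 v - D.coeff i.1.2.1 i.1.1 v) with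
    ⟨x, hx⟩ | ⟨w, hw, hpos, h0⟩
  · refine ⟨x, fun r a b ha hb hab => ?_⟩
    have hr : r ∈ R := Finset.mem_biUnion.2 ⟨a, Finset.mem_univ _, Finset.mem_Icc.2 ha⟩
    have := hx ⟨(⟨r, hr⟩, a, b), ha, hb, hab⟩
    simpa [sub_mul, Finset.sum_sub_distrib, sum_coeff_mul] using this
  · exfalso
    let M : A → ℤ → ℝ := fun a s => ∑ i : ι, w i *
      ((if i.1.2.2 = a then D.moment a i.1.1 s else 0) -
        (if i.1.2.1 = a then D.moment a i.1.1 s else 0))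
    have hcut : ∀ r c s, D.cutSum M r c s = ∑ i : ι, w i *
        ((if D.Meets i.1.2.2 r ∧ D.pos i.1.2.2 r < c then D.moment i.1.2.2 i.1.1 s else 0) -
          (if D.Meets i.1.2.1 r ∧ D.pos i.1.2.1 r < c then D.moment i.1.2.1 i.1.1 s else 0)) := by
      intro r c s
      have : ∀ a, (if D.Meets a r ∧ D.pos a r < c then M a s else 0) = ∑ i : ι, w i *
          ((if i.1.2.2 = a then
              if D.Meets a r ∧ D.pos a r < c then D.moment a i.1.1 s else 0 else 0) -
            (if i.1.2.1 = a then
              if D.Meets a r ∧ D.pos a r < c then D.moment a i.1.1 s else 0 else 0)) := by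
        intro a
        split_ifs <;> simp [M]
      rw [cutSum, Finset.sum_congr rfl fun a _ => this a, Finset.sum_comm]
      refine Finset.sum_congr rfl fun i _ => ?_
      rw [← Finset.mul_sum, Finset.sum_sub_distrib, Finset.sum_ite_eq, Finset.sum_ite_eq]
      simp
    have hdiff : ∀ r c, D.cutSum M r c (r + 1) + D.cutSum M r c (r - 1) - 2 * D.cutSum M r c r =
        - ∑ i : ι, if r = i.1.1 ∧ D.pos i.1.2.1 i.1.1 < c ∧ c ≤ D.pos i.1.2.2 i.1.1
          then w i else 0 := by
      intro r c
      have hv : ∑ i : ι, w i * ((∑ v, if D.row v = r ∧ D.rank v < c then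
            D.coeff i.1.2.2 i.1.1 v else 0) -
          ∑ v, if D.row v = r ∧ D.rank v < c then D.coeff i.1.2.1 i.1.1 v else 0) = 0 := by
        simp_rw [← Finset.sum_sub_distrib, Finset.mul_sum]
        rw [Finset.sum_comm]
        refine Finset.sum_eq_zero fun v _ => ?_
        split_ifs
        · exact h0 v
        · simp
      rw [eq_neg_iff_add_eq_zero, hcut, hcut, hcut, Finset.mul_sum, ← Finset.sum_add_distrib,
        ← Finset.sum_sub_distrib, ← Finset.sum_add_distrib]
      refine Eq.trans ?_ (neg_eq_zero.2 hv)
      rw [← Finset.sum_neg_distrib]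
      refine Finset.sum_congr rfl fun i _ => ?_
      have h1 := cut_second_difference i.2.1 r c
      have h2 := cut_second_difference i.2.2.1 r c
      have h3 : (if r = i.1.1 ∧ D.pos i.1.2.1 i.1.1 < c ∧ c ≤ D.pos i.1.2.2 i.1.1
          then (1 : ℝ) else 0) = (if r = i.1.1 ∧ D.pos i.1.2.1 i.1.1 < c then 1 else 0) -
          (if r = i.1.1 ∧ D.pos i.1.2.2 i.1.1 < c then 1 else 0) := by
        have := i.2.2.2
        by_cases hr : r = i.1.1
        · by_cases hc : D.pos i.1.2.2 i.1.1 < c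
          · simp [hr, hc, this.trans hc, not_le.2 hc]
          · simp [hr, hc, not_lt.1 hc]
        · simp [hr]
      have h4 : (if r = i.1.1 ∧ D.pos i.1.2.1 i.1.1 < c ∧ c ≤ D.pos i.1.2.2 i.1.1
          then w i else 0) = w i * (if r = i.1.1 ∧ D.pos i.1.2.1 i.1.1 < c ∧
            c ≤ D.pos i.1.2.2 i.1.1 then (1 : ℝ) else 0) := by simp
      rw [h4, h3]
      have h5 : ∀ (p : Prop) [Decidable p] (u v z : ℝ), (if p then u + v - 2 * z else 0) =
          (if p then u else 0) + (if p then v else 0) - 2 * (if p then z else 0) := by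
        intro p _ u v z
        split_ifs <;> simp
      rw [h5] at h1 h2
      linear_combination w i * h2 - w i * h1
    have hM : D.IsStress M := by
      constructor
      · intro a s hs
        refine Finset.sum_eq_zero fun i _ => ?_
        have h1 : (if i.1.2.2 = a then D.moment a i.1.1 s else 0) = 0 := by
          split_ifs with h
          exacts [moment_eq_zero (h ▸ i.2.2.1) hs, rfl]
        have h2 : (if i.1.2.1 = a then D.moment a i.1.1 s else 0) = 0 := by
          split_ifs with h
          exacts [moment_eq_zero (h ▸ i.2.1) hs, rfl]
        rw [h1, h2]
        simp
      · intro r c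
        rw [← sub_nonpos, hdiff, neg_nonpos]
        refine Finset.sum_nonneg fun i _ => ?_
        split_ifs
        exacts [hw i, le_rfl]
    obtain ⟨i, hi⟩ := hpos
    have := hdiff i.1.1 (D.pos i.1.2.2 i.1.1)
    rw [hM.cutSum_eq_zero, hM.cutSum_adjacent_eq_zero (Or.inl rfl),
      hM.cutSum_adjacent_eq_zero (Or.inr (by ring)), eq_comm] at this
    norm_num at this
    rw [Finset.sum_eq_zero_iff_of_nonneg] at this
    · have h1 := this i (Finset.mem_univ _)
      rw [if_pos ⟨rfl, i.2.2.2, le_rfl⟩] at h1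
      exact hi.ne' h1
    · intro j _
      split_ifs
      exacts [hw j, le_rfl]

end Realization

end LevelDrawing

/-- A set of points that climbs from row `m` to row `n`, crossing the strips between consecutive
rows in segments. -/
structure IsAscending (S : Set Pt) (m n : ℤ) : Prop where
  mem_Icc : ∀ p ∈ S, p.2 ∈ Icc (m : ℝ) n
  ordConnected : ∀ y, (rowSlice S y).OrdConnected
  exists_segment : ∀ r : ℤ, m ≤ r → r < n →
    ∃ a b : ℝ, segment ℝ ((a, (r : ℝ)) : Pt) (b, (r : ℝ) + 1) ⊆ S

theorem mem_segment_of_lt {a b x y : ℝ} {c d : ℝ} (hcd : c < d) :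
    ((x, y) : Pt) ∈ segment ℝ ((a, c) : Pt) (b, d) ↔
      y ∈ Icc c d ∧ x = (1 - (y - c) / (d - c)) * a + (y - c) / (d - c) * b := by
  have h0 : 0 < d - c := sub_pos.2 hcd
  rw [segment_eq_image]
  simp only [mem_image, Prod.smul_mk, smul_eq_mul, Prod.mk_add_mk, Prod.mk.injEq, mem_Icc]
  constructor
  · rintro ⟨t, ⟨ht0, ht1⟩, hx, hy⟩
    have ht : (y - c) / (d - c) = t := by
      rw [div_eq_iff h0.ne']
      linear_combination -hy
    rw [ht]
    refine ⟨⟨?_, ?_⟩, hx.symm⟩ <;> nlinarith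
  · rintro ⟨⟨h1, h2⟩, hx⟩
    refine ⟨(y - c) / (d - c), ⟨div_nonneg (by linarith) h0.le, (div_le_one h0).2 (by linarith)⟩,
      hx.symm, ?_⟩
    field_simp
    ring

theorem mem_segment_horizontal {a b x y c : ℝ} (hab : a ≤ b) :
    ((x, y) : Pt) ∈ segment ℝ ((a, c) : Pt) (b, c) ↔ y = c ∧ x ∈ Icc a b := by
  rw [← segment_eq_Icc hab, segment_eq_image, segment_eq_image]
  simp only [mem_image, Prod.smul_mk, smul_eq_mul, Prod.mk_add_mk, Prod.mk.injEq]
  constructor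
  · rintro ⟨t, ht, hx, hy⟩
    exact ⟨by linear_combination -hy, t, ht, hx⟩
  · rintro ⟨rfl, t, ht, hx⟩
    exact ⟨t, ht, hx, by ring⟩

theorem isAscending_segment {p q : Pt} {m n : ℤ} (hp : p.2 = m) (hq : q.2 = n) (hmn : m ≤ n) :
    IsAscending (segment ℝ p q) m n := by
  have hmn' : (m : ℝ) ≤ n := by exact_mod_cast hmn
  obtain ⟨a, y⟩ := p
  obtain ⟨b, y'⟩ := q
  obtain rfl : y = m := hp
  obtain rfl : y' = n := hq
  have hconv := convex_segment (𝕜 := ℝ) ((a, (m : ℝ)) : Pt) (b, (n : ℝ))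
  refine ⟨fun z hz => ?_, fun y => ?_, fun r hr hr' => ?_⟩
  · rw [← segment_eq_Icc hmn']
    have := mem_image_of_mem (LinearMap.snd ℝ ℝ ℝ).toAffineMap hz
    rwa [image_segment] at this
  · refine Convex.ordConnected fun c hc d hd u v hu hv huv => ?_
    have := hconv hc hd hu hv huv
    simpa [rowSlice, ← add_mul, huv] using this
  · have hlt : (m : ℝ) < n := by exact_mod_cast hr.trans_lt hr'
    have h1 : (m : ℝ) ≤ r := by exact_mod_cast hr
    have h2 : (r : ℝ) + 1 ≤ n := by exact_mod_cast hr'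
    exact ⟨_, _, hconv.segment_subset ((mem_segment_of_lt hlt).2 ⟨⟨h1, by linarith⟩, rfl⟩)
      ((mem_segment_of_lt hlt).2 ⟨⟨by linarith, h2⟩, rfl⟩)⟩

theorem isAscending_singleton {p : Pt} {m : ℤ} (h : p.2 = m) : IsAscending {p} m m := by
  simpa using isAscending_segment h h le_rfl

theorem IsAscending.union {S T : Set Pt} {m k n : ℤ} {q : Pt} (hS : IsAscending S m k)
    (hT : IsAscending T k n) (hqS : q ∈ S) (hqT : q ∈ T) (hq : q.2 = k) :
    IsAscending (S ∪ T) m n where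
  mem_Icc p hp := by
    have h1 := hS.mem_Icc q hqS
    have h2 := hT.mem_Icc q hqT
    rcases hp with hp | hp
    · have := hS.mem_Icc p hp
      exact ⟨this.1, by linarith [this.2, h2.2]⟩
    · have := hT.mem_Icc p hp
      exact ⟨by linarith [this.1, h1.1], this.2⟩
  ordConnected y := by
    have hU : rowSlice (S ∪ T) y = rowSlice S y ∪ rowSlice T y := rfl
    rw [hU]
    rcases lt_trichotomy y k with hy | rfl | hy
    · have : rowSlice T y = ∅ := eq_empty_of_forall_notMem fun x hx =>
        absurd (hT.mem_Icc _ hx).1 (not_le.2 hy)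
      rw [this, union_empty]
      exact hS.ordConnected y
    · rw [← isPreconnected_iff_ordConnected]
      exact IsPreconnected.union q.1 (show (q.1, (k : ℝ)) ∈ S from hq ▸ hqS)
        (show (q.1, (k : ℝ)) ∈ T from hq ▸ hqT)
        (isPreconnected_iff_ordConnected.2 (hS.ordConnected _))
        (isPreconnected_iff_ordConnected.2 (hT.ordConnected _))
    · have : rowSlice S y = ∅ := eq_empty_of_forall_notMem fun x hx =>
        absurd (hS.mem_Icc _ hx).2 (not_le.2 hy)
      rw [this, empty_union]
      exact hT.ordConnected y
  exists_segment r hr hr' := by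
    rcases lt_or_ge r k with h | h
    · obtain ⟨a, b, hab⟩ := hS.exists_segment r hr h
      exact ⟨a, b, hab.trans subset_union_left⟩
    · obtain ⟨a, b, hab⟩ := hT.exists_segment r h hr'
      exact ⟨a, b, hab.trans subset_union_right⟩

theorem mem_chainSet_head (p : Pt) (l : List Pt) : p ∈ chainSet (p :: l) := by
  cases l with
  | nil => rfl
  | cons q l => exact Or.inl (left_mem_segment ℝ p q)

theorem mem_chainSet_getLast (p : Pt) (l : List Pt) :
    (p :: l).getLast (List.cons_ne_nil p l) ∈ chainSet (p :: l) := by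
  induction l generalizing p with
  | nil => rfl
  | cons q l ih => exact Or.inr (by simpa using ih q)

theorem isAscending_chainSet (p : Pt) (l : List Pt) (hrows : ∀ q ∈ p :: l, ∃ k : ℤ, q.2 = k)
    (hl : List.IsChain (· ≤ ·) ((p :: l).map Prod.snd)) :
    ∃ m n : ℤ, p.2 = m ∧ ((p :: l).getLast (List.cons_ne_nil p l)).2 = n ∧
      IsAscending (chainSet (p :: l)) m n := by
  induction l generalizing p with
  | nil =>
    obtain ⟨m, hm⟩ := hrows p (by simp)
    exact ⟨m, m, hm, hm, isAscending_singleton hm⟩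
  | cons q l ih =>
    obtain ⟨m, hm⟩ := hrows p (by simp)
    simp only [List.map_cons, List.isChain_cons_cons] at hl
    obtain ⟨k, n, hk, hn, h⟩ := ih q (fun z hz => hrows z (List.mem_cons_of_mem p hz))
      (by simpa using hl.2)
    have hmk : m ≤ k := by exact_mod_cast hm ▸ hk ▸ hl.1
    exact ⟨m, n, hm, by simpa using hn, (isAscending_segment hm hk hmk).union h
      (right_mem_segment ℝ p q) (mem_chainSet_head q l) hk⟩

theorem isAscending_chainSet_of_ge (p : Pt) (l : List Pt)
    (hrows : ∀ q ∈ p :: l, ∃ k : ℤ, q.2 = k)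
    (hl : List.IsChain (· ≥ ·) ((p :: l).map Prod.snd)) :
    ∃ m n : ℤ, p.2 = m ∧ ((p :: l).getLast (List.cons_ne_nil p l)).2 = n ∧
      IsAscending (chainSet (p :: l)) n m := by
  induction l generalizing p with
  | nil =>
    obtain ⟨m, hm⟩ := hrows p (by simp)
    exact ⟨m, m, hm, hm, isAscending_singleton hm⟩
  | cons q l ih =>
    obtain ⟨m, hm⟩ := hrows p (by simp)
    simp only [List.map_cons, List.isChain_cons_cons] at hl
    obtain ⟨k, n, hk, hn, h⟩ := ih q (fun z hz => hrows z (List.mem_cons_of_mem p hz))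
      (by simpa using hl.2)
    have hkm : k ≤ m := by exact_mod_cast hm ▸ hk ▸ hl.1
    refine ⟨m, n, hm, by simpa using hn, ?_⟩
    change IsAscending (segment ℝ p q ∪ chainSet (q :: l)) n m
    rw [union_comm, segment_symm]
    exact h.union (isAscending_segment hk hm hkm) (mem_chainSet_head q l)
      (left_mem_segment ℝ q p) hk

theorem lt_of_disjoint_of_ordConnected {s t : Set ℝ} (hs : s.OrdConnected) (ht : t.OrdConnected)
    (hst : Disjoint s t) {a b : ℝ} (ha : a ∈ s) (hb : b ∈ t) (hab : a < b) :
    ∀ x ∈ s, ∀ y ∈ t, x < y := by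
  rw [Set.disjoint_left] at hst
  intro x hx y hy
  by_contra! hyx
  rcases le_or_gt b x with h | h
  · exact hst (hs.out ha hx ⟨hab.le, h⟩) hb
  rcases le_or_gt y a with h' | h'
  · exact hst ha (ht.out hy hb ⟨h', hab.le⟩)
  · exact hst hx (ht.out hy hb ⟨hyx, h.le⟩)

theorem exists_monotone_strictMonoOn (T : Finset ℝ) :
    ∃ k : ℝ → ℤ, Monotone k ∧ StrictMonoOn k T := by
  classical
  have hmono : ∀ s t : ℝ, s ≤ t → (T.filter (· < s)) ⊆ (T.filter (· < t)) := fun s t hst u hu => by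
    rw [Finset.mem_filter] at hu ⊢
    exact ⟨hu.1, hu.2.trans_le hst⟩
  refine ⟨fun t => (T.filter (· < t)).card, fun s t hst => ?_, fun s hs t _ hst => ?_⟩
  · exact Nat.cast_le.2 (Finset.card_le_card (hmono s t hst))
  · refine Nat.cast_lt.2 (Finset.card_lt_card ⟨hmono s t hst.le, fun h => ?_⟩)
    have : s ∈ T.filter (· < s) := h (Finset.mem_filter.2 ⟨hs, hst⟩)
    exact lt_irrefl s (Finset.mem_filter.1 this).2

/-- A planar system of ascending curves joining points in integer rows; the constant curves at the
points are part of the system. -/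
structure CurveSystem (V A : Type) where
  pos : V → Pt
  pos_inj : Function.Injective pos
  row : V → ℤ
  pos_snd : ∀ v, (pos v).2 = row v
  lo : A → V
  hi : A → V
  curve : A → Set Pt
  isAscending : ∀ a, IsAscending (curve a) (row (lo a)) (row (hi a))
  lo_mem : ∀ a, pos (lo a) ∈ curve a
  hi_mem : ∀ a, pos (hi a) ∈ curve a
  fst_le : ∀ a, row (lo a) = row (hi a) → (pos (lo a)).1 ≤ (pos (hi a)).1
  const : V → A
  lo_const : ∀ v, lo (const v) = v
  hi_const : ∀ v, hi (const v) = v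
  common : ∀ a b, a ≠ b → ∀ p ∈ curve a ∩ curve b,
    ∃ w, (w = lo a ∨ w = hi a) ∧ (w = lo b ∨ w = hi b) ∧ p = pos w
  eq_of_mem_ends : ∀ a b, a ≠ b → ∀ w w', (w = lo a ∨ w = hi a) → (w = lo b ∨ w = hi b) →
    (w' = lo a ∨ w' = hi a) → (w' = lo b ∨ w' = hi b) → w = w'

namespace CurveSystem

variable {V A : Type} (C : CurveSystem V A)

/-- The curve `a` meets row `r`. -/
def Meets (a : A) (r : ℤ) : Prop := r ∈ Icc (C.row (C.lo a)) (C.row (C.hi a))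

variable {C}

theorem row_le (a : A) : C.row (C.lo a) ≤ C.row (C.hi a) := by
  have := ((C.isAscending a).mem_Icc _ (C.lo_mem a)).2
  rw [C.pos_snd] at this
  exact_mod_cast this

theorem pos_eq (v : V) : C.pos v = ((C.pos v).1, (C.row v : ℝ)) := Prod.ext rfl (C.pos_snd v)

theorem eq_of_fst_eq {v w : V} (h : (C.pos v).1 = (C.pos w).1) (h' : C.row v = C.row w) : v = w :=
  C.pos_inj (Prod.ext h (by rw [C.pos_snd, C.pos_snd, h']))

theorem meets_lo (a : A) : C.Meets a (C.row (C.lo a)) := ⟨le_rfl, C.row_le a⟩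

theorem meets_hi (a : A) : C.Meets a (C.row (C.hi a)) := ⟨C.row_le a, le_rfl⟩

theorem meets_of_end {a : A} {w : V} (h : w = C.lo a ∨ w = C.hi a) : C.Meets a (C.row w) := by
  rcases h with rfl | rfl
  exacts [C.meets_lo a, C.meets_hi a]

theorem exists_mem {a : A} {r : ℤ} (h : C.Meets a r) : ∃ x : ℝ, (x, (r : ℝ)) ∈ C.curve a := by
  rcases h.2.eq_or_lt with rfl | h'
  · exact ⟨(C.pos (C.hi a)).1, C.pos_eq (C.hi a) ▸ C.hi_mem a⟩
  · obtain ⟨x, y, hxy⟩ := (C.isAscending a).exists_segment r h.1 h'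
    exact ⟨x, hxy (left_mem_segment ℝ _ _)⟩

variable (C)

open Classical in
/-- A point of the curve `a` in row `r`, namely its left endpoint if `r` is its lowest row and
its other endpoint if `r` is another row, the highest one. -/
noncomputable def left (a : A) (r : ℤ) : ℝ :=
  if r = C.row (C.lo a) then (C.pos (C.lo a)).1
  else if r = C.row (C.hi a) then (C.pos (C.hi a)).1
  else if h : C.Meets a r then (C.exists_mem h).choose else 0

open Classical in
/-- The right endpoint of a horizontal curve, the curve itself otherwise. -/
noncomputable def right (a : A) : A :=
  if C.row (C.lo a) = C.row (C.hi a) then C.const (C.hi a) else a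

variable {C}

theorem left_lo (a : A) : C.left a (C.row (C.lo a)) = (C.pos (C.lo a)).1 := by simp [left]

theorem left_hi {a : A} (h : C.row (C.lo a) < C.row (C.hi a)) :
    C.left a (C.row (C.hi a)) = (C.pos (C.hi a)).1 := by simp [left, h.ne']

theorem left_mem {a : A} {r : ℤ} (h : C.Meets a r) : (C.left a r, (r : ℝ)) ∈ C.curve a := by
  unfold left
  split_ifs with h1 h2
  · exact h1 ▸ C.pos_eq (C.lo a) ▸ C.lo_mem a
  · exact h2 ▸ C.pos_eq (C.hi a) ▸ C.hi_mem a
  · exact (C.exists_mem h).choose_spec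

theorem left_const (v : V) : C.left (C.const v) (C.row v) = (C.pos v).1 := by
  simpa [lo_const] using C.left_lo (C.const v)

theorem meets_const {v : V} {r : ℤ} : C.Meets (C.const v) r ↔ r = C.row v := by
  simp [Meets, lo_const, hi_const]

theorem meets_right {a : A} {r : ℤ} (h : C.Meets a r) : C.Meets (C.right a) r := by
  unfold right
  split_ifs with h'
  · rw [meets_const]
    exact le_antisymm h.2 (h' ▸ h.1)
  · exact h

theorem right_mem {a : A} {r : ℤ} (h : C.Meets a r) :
    (C.left (C.right a) r, (r : ℝ)) ∈ C.curve a := by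
  unfold right
  split_ifs with h'
  · obtain rfl : r = C.row (C.hi a) := le_antisymm h.2 (h' ▸ h.1)
    rw [left_const]
    exact C.pos_eq (C.hi a) ▸ C.hi_mem a
  · exact left_mem h

theorem left_le_right {a : A} {r : ℤ} (h : C.Meets a r) : C.left a r ≤ C.left (C.right a) r := by
  unfold right
  split_ifs with h'
  · obtain rfl : r = C.row (C.hi a) := le_antisymm h.2 (h' ▸ h.1)
    rw [left_const, ← h', left_lo]
    exact C.fst_le a h'
  · exact le_rfl

theorem fst_mem_Icc {a : A} {w : V} (h : w = C.lo a ∨ w = C.hi a) :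
    (C.pos w).1 ∈ Icc (C.left a (C.row w)) (C.left (C.right a) (C.row w)) := by
  have hle := left_le_right (meets_of_end h)
  rcases h with rfl | rfl
  · rw [left_lo] at hle ⊢
    exact ⟨le_rfl, hle⟩
  · rcases (C.row_le a).eq_or_lt with h' | h'
    · have : C.right a = C.const (C.hi a) := if_pos h'
      rw [this, left_const] at hle ⊢
      exact ⟨hle, le_rfl⟩
    · rw [left_hi h'] at hle ⊢
      exact ⟨le_rfl, hle⟩

theorem Icc_subset_rowSlice {a : A} {r : ℤ} (h : C.Meets a r) :
    Icc (C.left a r) (C.left (C.right a) r) ⊆ rowSlice (C.curve a) r :=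
  ((C.isAscending a).ordConnected r).out (left_mem h) (right_mem h)

theorem exists_common {a b : A} (hab : a ≠ b) {x : ℝ} {r : ℤ}
    (ha : x ∈ rowSlice (C.curve a) r) (hb : x ∈ rowSlice (C.curve b) r) :
    ∃ w, (w = C.lo a ∨ w = C.hi a) ∧ (w = C.lo b ∨ w = C.hi b) ∧ r = C.row w ∧
      x = (C.pos w).1 := by
  obtain ⟨w, h1, h2, h3⟩ := C.common a b hab (x, r) ⟨ha, hb⟩
  refine ⟨w, h1, h2, ?_, congrArg Prod.fst h3⟩
  have := congrArg Prod.snd h3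
  rw [C.pos_snd] at this
  exact Int.cast_injective (α := ℝ) this

theorem lt_of_right_lt {a b : A} (hab : a ≠ b) {r : ℤ} (ha : C.Meets a r) (hb : C.Meets b r)
    (h : C.left (C.right a) r < C.left b r) :
    ∀ x ∈ rowSlice (C.curve a) r, ∀ y ∈ rowSlice (C.curve b) r, x < y := by
  refine lt_of_disjoint_of_ordConnected ((C.isAscending a).ordConnected r)
    ((C.isAscending b).ordConnected r) (Set.disjoint_left.2 fun x hxa hxb => ?_)
    (right_mem ha) (left_mem hb) h
  obtain ⟨w, hwa, hwb, rfl, -⟩ := exists_common hab hxa hxb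
  exact absurd ((fst_mem_Icc hwb).1.trans (fst_mem_Icc hwa).2) (not_le.2 h)

theorem left_noncrossing {a b : A} {r : ℤ} (ha : C.Meets a r) (ha' : C.Meets a (r + 1))
    (hb : C.Meets b r) (hb' : C.Meets b (r + 1)) (h : C.left a r < C.left b r) :
    C.left a (r + 1) ≤ C.left b (r + 1) := by
  by_contra! h'
  have hab : a ≠ b := by
    rintro rfl
    exact lt_irrefl _ h
  have hra : C.right a = a := if_neg fun h0 => by
    have := ha.1
    have := ha'.2
    omega
  have hrb : C.right b = b := if_neg fun h0 => by
    have := hb.1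
    have := hb'.2
    omega
  have h1 := lt_of_right_lt hab ha hb (by rwa [hra])
  have h2 := lt_of_right_lt hab.symm hb' ha' (by rwa [hrb])
  obtain ⟨a₁, a₂, hA⟩ := (C.isAscending a).exists_segment r ha.1 (by have := ha'.2; omega)
  obtain ⟨b₁, b₂, hB⟩ := (C.isAscending b).exists_segment r hb.1 (by have := hb'.2; omega)
  have h3 : a₁ < b₁ := h1 _ (hA (left_mem_segment ℝ _ _)) _ (hB (left_mem_segment ℝ _ _))
  have h4 : b₂ < a₂ := by
    refine h2 b₂ ?_ a₂ ?_
    · simpa [rowSlice] using hB (right_mem_segment ℝ _ _)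
    · simpa [rowSlice] using hA (right_mem_segment ℝ _ _)
  have hd : 0 < (b₁ - a₁) + (a₂ - b₂) := by linarith
  let t := (b₁ - a₁) / ((b₁ - a₁) + (a₂ - b₂))
  have ht0 : 0 < t := div_pos (by linarith) hd
  have ht1 : t < 1 := (div_lt_one hd).2 (by linarith)
  have hlt : (r : ℝ) < r + 1 := by linarith
  have ht : (1 - t) * a₁ + t * a₂ = (1 - t) * b₁ + t * b₂ := by
    have : t * ((b₁ - a₁) + (a₂ - b₂)) = b₁ - a₁ := div_mul_cancel₀ _ hd.ne'
    linear_combination this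
  have hIcc : (r : ℝ) + t ∈ Icc (r : ℝ) (r + 1) := ⟨by linarith, by linarith⟩
  have hpa : ((1 - t) * a₁ + t * a₂, (r : ℝ) + t) ∈ C.curve a :=
    hA ((mem_segment_of_lt hlt).2 ⟨hIcc, by simp⟩)
  have hpb : ((1 - t) * a₁ + t * a₂, (r : ℝ) + t) ∈ C.curve b :=
    hB ((mem_segment_of_lt hlt).2 ⟨hIcc, by simp [ht]⟩)
  obtain ⟨w, -, -, hw⟩ := C.common a b hab _ ⟨hpa, hpb⟩
  have hw' := congrArg Prod.snd hw
  rw [C.pos_snd] at hw'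
  simp only at hw'
  have h5 : r < C.row w := by exact_mod_cast (by linarith : (r : ℝ) < C.row w)
  have h6 : C.row w < r + 1 := by exact_mod_cast (by linarith : (C.row w : ℝ) < r + 1)
  omega

theorem exists_levelDrawing [Finite A] (C : CurveSystem V A) :
    ∃ D : LevelDrawing V A, D.row = C.row ∧ D.lo = C.lo ∧
      (∀ a, C.row (C.lo a) < C.row (C.hi a) → D.hi a = C.hi a) ∧
      (∀ a, C.row (C.lo a) = C.row (C.hi a) → D.hi a = C.lo a) ∧
      ∀ a b r, C.Meets a r → C.Meets b r → (D.pos a r < D.pos b r ↔ C.left a r < C.left b r) := by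
  classical
  have := Fintype.ofFinite A
  obtain ⟨k, hk, hk'⟩ := exists_monotone_strictMonoOn (Finset.univ.biUnion fun a : A =>
    (Finset.Icc (C.row (C.lo a)) (C.row (C.hi a))).image (C.left a))
  have hlt : ∀ a b r, C.Meets a r → C.Meets b r →
      (k (C.left a r) < k (C.left b r) ↔ C.left a r < C.left b r) := by
    have hmem : ∀ a r, C.Meets a r → C.left a r ∈ (↑(Finset.univ.biUnion fun a : A =>
        (Finset.Icc (C.row (C.lo a)) (C.row (C.hi a))).image (C.left a)) : Set ℝ) :=
      fun a r h => Finset.mem_coe.2 (Finset.mem_biUnion.2 ⟨a, Finset.mem_univ a,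
        Finset.mem_image_of_mem _ (Finset.mem_Icc.2 h)⟩)
    exact fun a b r ha hb => hk'.lt_iff_lt (hmem a r ha) (hmem b r hb)
  have heq : ∀ a b r, C.Meets a r → C.Meets b r → k (C.left a r) = k (C.left b r) →
      C.left a r = C.left b r := fun a b r ha hb h =>
    le_antisymm (not_lt.1 fun h' => h.symm.not_lt ((hlt b a r hb ha).2 h'))
      (not_lt.1 fun h' => h.not_lt ((hlt a b r ha hb).2 h'))
  let hi : A → V := fun a => if C.row (C.lo a) = C.row (C.hi a) then C.lo a else C.hi a
  have hhi : ∀ a, C.row (hi a) = C.row (C.hi a) := fun a => by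
    by_cases h : C.row (C.lo a) = C.row (C.hi a)
    · simp only [hi, if_pos h, h]
    · simp only [hi, if_neg h]
  have hhi_of_lt : ∀ a, C.row (C.lo a) < C.row (C.hi a) → hi a = C.hi a := fun a h => if_neg h.ne
  refine ⟨{
    row := C.row
    rank := fun v => k (C.pos v).1
    lo := C.lo
    hi := hi
    pos := fun a r => k (C.left a r)
    row_le := fun a => (hhi a).symm ▸ C.row_le a
    pos_lo := fun a => by rw [left_lo]
    pos_hi := fun a => ?_
    endpoint_of_pos_eq := fun a b r hab ha hb h => ?_
    noncrossing := fun a b r ha ha' hb hb' h => ?_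
    eq_of_ends := fun a b h hlo hh hlo' hh' => ?_ }, rfl, rfl, hhi_of_lt, fun a h => if_pos h, hlt⟩
  · rcases (C.row_le a).eq_or_lt with h | h
    · have : hi a = C.lo a := if_pos h
      rw [this, left_lo]
    · rw [hhi_of_lt a h, left_hi h]
  · rw [hhi] at ha hb ⊢
    obtain ⟨w, hw, -, rfl, -⟩ := exists_common hab (left_mem ha)
      (heq a b r ha hb h ▸ left_mem hb)
    exact hw.imp (congrArg C.row) (congrArg C.row)
  · rw [hhi] at ha ha' hb hb'
    exact hk (left_noncrossing ha ha' hb hb' ((hlt a b r ha hb).1 h))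
  · rw [hhi] at h
    rw [hhi, hhi] at hh
    have hb : C.row (C.lo b) < C.row (C.hi b) := by omega
    rw [hhi_of_lt a h, hhi_of_lt b hb] at hh'
    have hkv : ∀ v w, C.row v = C.row w → k (C.pos v).1 = k (C.pos w).1 → v = w := by
      intro v w hvw h
      refine eq_of_fst_eq ?_ hvw
      rw [← left_const v, ← left_const w] at h ⊢
      rw [← hvw] at h ⊢
      exact heq _ _ _ (meets_const.2 rfl) (meets_const.2 hvw) h
    have e1 := hkv _ _ hlo hlo'
    have e2 := hkv _ _ hh hh'
    by_contra hab
    have := C.eq_of_mem_ends a b hab (C.lo a) (C.hi a) (Or.inl rfl) (Or.inl e1) (Or.inr rfl)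
      (Or.inr e2)
    exact h.ne (congrArg C.row this)

variable (C) in
/-- The abscissa at height `t` of the curve `a`, drawn straight with vertex abscissae `x`; it is
that of the left endpoint if `a` is horizontal. -/
noncomputable def abscissa (x : V → ℝ) (a : A) (t : ℝ) : ℝ :=
  (1 - (t - C.row (C.lo a)) / (C.row (C.hi a) - C.row (C.lo a))) * x (C.lo a) +
    (t - C.row (C.lo a)) / (C.row (C.hi a) - C.row (C.lo a)) * x (C.hi a)

theorem exists_abscissa_lt [Fintype V] [Finite A] (C : CurveSystem V A) :
    ∃ x : V → ℝ, ∀ a b r, C.Meets a r → C.Meets b r → C.left a r < C.left b r →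
      C.abscissa x a r < C.abscissa x b r := by
  have := Fintype.ofFinite A
  obtain ⟨D, hrow, hlo, hlt, heq, hpos⟩ := C.exists_levelDrawing
  obtain ⟨x, hx⟩ := D.exists_abscissa_lt
  have habs : ∀ a r, D.abscissa x a r = C.abscissa x a r := fun a r => by
    rcases (C.row_le a).eq_or_lt with h | h
    · simp [LevelDrawing.abscissa, LevelDrawing.height, abscissa, hrow, hlo, heq a h, h]
    · simp [LevelDrawing.abscissa, LevelDrawing.height, abscissa, hrow, hlo, hlt a h]
  have hmeets : ∀ a r, C.Meets a r → D.Meets a r := fun a r h => by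
    rcases (C.row_le a).eq_or_lt with h' | h'
    · simpa [LevelDrawing.Meets, hrow, hlo, heq a h', Meets, h'] using h
    · simpa [LevelDrawing.Meets, hrow, hlo, hlt a h', Meets] using h
  refine ⟨x, fun a b r ha hb h => ?_⟩
  rw [← habs, ← habs]
  exact hx r a b (hmeets a r ha) (hmeets b r hb) ((hpos a b r ha hb).2 h)

theorem abscissa_lo (x : V → ℝ) (a : A) : C.abscissa x a (C.row (C.lo a)) = x (C.lo a) := by
  simp [abscissa]

theorem abscissa_hi (x : V → ℝ) {a : A} (h : C.row (C.lo a) < C.row (C.hi a)) :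
    C.abscissa x a (C.row (C.hi a)) = x (C.hi a) := by
  have : (C.row (C.hi a) : ℝ) - C.row (C.lo a) ≠ 0 :=
    (sub_pos.2 (by exact_mod_cast h : (C.row (C.lo a) : ℝ) < C.row (C.hi a))).ne'
  simp [abscissa, div_self this]

theorem abscissa_const (x : V → ℝ) (v : V) : C.abscissa x (C.const v) (C.row v) = x v := by
  simpa [lo_const] using C.abscissa_lo x (C.const v)

theorem abscissa_eq_of_left_eq (x : V → ℝ) {a : A} {w : V} (h : w = C.lo a ∨ w = C.hi a)
    (hw : C.left a (C.row w) = (C.pos w).1) : C.abscissa x a (C.row w) = x w := by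
  rcases h with rfl | rfl
  · exact C.abscissa_lo x a
  · rcases (C.row_le a).eq_or_lt with h | h
    · have : C.lo a = C.hi a := by
        refine eq_of_fst_eq ?_ h
        rw [← hw, ← h, left_lo]
      rw [← this, C.abscissa_lo]
    · exact C.abscissa_hi x h

theorem abscissa_eq_abscissa (x : V → ℝ) {a b : A} {r : ℤ} (ha : C.Meets a r) (hb : C.Meets b r)
    (h : C.left a r = C.left b r) : C.abscissa x a r = C.abscissa x b r := by
  by_cases hab : a = b
  · rw [hab]
  obtain ⟨w, hwa, hwb, rfl, hw⟩ := exists_common hab (left_mem ha) (h ▸ left_mem hb)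
  rw [abscissa_eq_of_left_eq x hwa hw, abscissa_eq_of_left_eq x hwb (h.symm.trans hw)]

theorem abscissa_interpolate (x : V → ℝ) (a : A) (r t : ℝ) :
    C.abscissa x a (r + t) = (1 - t) * C.abscissa x a r + t * C.abscissa x a (r + 1) := by
  unfold abscissa
  ring

variable (C) in
/-- The straight segment replacing the curve `a`, for vertex abscissae `x`. -/
def straight (x : V → ℝ) (a : A) : Set Pt :=
  segment ℝ ((x (C.lo a), (C.row (C.lo a) : ℝ)) : Pt) (x (C.hi a), (C.row (C.hi a) : ℝ))

section Straight

variable {x : V → ℝ} (hx : ∀ a b r, C.Meets a r → C.Meets b r → C.left a r < C.left b r →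
  C.abscissa x a r < C.abscissa x b r)
include hx

theorem abscissa_lt_iff {a b : A} {r : ℤ} (ha : C.Meets a r) (hb : C.Meets b r) :
    C.abscissa x a r < C.abscissa x b r ↔ C.left a r < C.left b r := by
  refine ⟨fun h => ?_, hx a b r ha hb⟩
  by_contra! h'
  rcases h'.eq_or_lt with h' | h'
  · exact h.ne' (abscissa_eq_abscissa x hb ha h')
  · exact lt_asymm h (hx b a r hb ha h')

theorem abscissa_le_iff {a b : A} {r : ℤ} (ha : C.Meets a r) (hb : C.Meets b r) :
    C.abscissa x a r ≤ C.abscissa x b r ↔ C.left a r ≤ C.left b r := by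
  rw [← not_lt, ← not_lt, abscissa_lt_iff hx hb ha]

theorem mem_straight_row {a : A} {r : ℤ} {y : ℝ} : (y, (r : ℝ)) ∈ C.straight x a ↔
    C.Meets a r ∧ y ∈ Icc (C.abscissa x a r) (C.abscissa x (C.right a) r) := by
  unfold straight
  rcases (C.row_le a).eq_or_lt with h | h
  · have hr : C.right a = C.const (C.hi a) := if_pos h
    have hle : x (C.lo a) ≤ x (C.hi a) := by
      have h1 := (abscissa_le_iff hx (C.meets_lo a) (meets_right (C.meets_lo a))).2
        (left_le_right (C.meets_lo a))
      rwa [hr, abscissa_lo, h, abscissa_const] at h1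
    rw [← h, mem_segment_horizontal hle]
    have hm : C.Meets a r ↔ (r : ℝ) = C.row (C.lo a) := by
      simp [Meets, ← h, le_antisymm_iff]
    rw [hm]
    refine and_congr_right fun h' => ?_
    rw [h', hr, abscissa_lo, h, abscissa_const]
  · have hr : C.right a = a := if_neg h.ne
    have h' : (C.row (C.lo a) : ℝ) < C.row (C.hi a) := by exact_mod_cast h
    rw [mem_segment_of_lt h', hr, Icc_self, mem_singleton_iff]
    simp [Meets, abscissa]

omit hx in
theorem mem_straight_of_notInt {a : A} {y t : ℝ} (ht : ∀ r : ℤ, t ≠ r)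
    (h : (y, t) ∈ C.straight x a) :
    C.Meets a ⌊t⌋ ∧ C.Meets a (⌊t⌋ + 1) ∧ y = C.abscissa x a t := by
  unfold straight at h
  rcases (C.row_le a).eq_or_lt with h' | h'
  · have := (isAscending_segment rfl rfl (C.row_le a)).mem_Icc _ h
    rw [h'] at this
    exact absurd (le_antisymm this.2 this.1) (ht _)
  · have h'' : (C.row (C.lo a) : ℝ) < C.row (C.hi a) := by exact_mod_cast h'
    obtain ⟨⟨h1, h2⟩, h3⟩ := (mem_segment_of_lt h'').1 h
    have h4 : C.row (C.lo a) ≤ ⌊t⌋ := Int.le_floor.2 h1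
    have h5 : ⌊t⌋ < C.row (C.hi a) := Int.floor_lt.2 (h2.lt_of_ne (ht _))
    exact ⟨⟨h4, h5.le⟩, ⟨by omega, h5⟩, h3⟩

theorem straight_common_row {a b : A} (hab : a ≠ b) {y : ℝ} {r : ℤ}
    (ha : (y, (r : ℝ)) ∈ C.straight x a) (hb : (y, (r : ℝ)) ∈ C.straight x b) :
    ∃ w, (w = C.lo a ∨ w = C.hi a) ∧ (w = C.lo b ∨ w = C.hi b) ∧ r = C.row w ∧ y = x w := by
  obtain ⟨ha, hay⟩ := (mem_straight_row hx).1 ha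
  obtain ⟨hb, hby⟩ := (mem_straight_row hx).1 hb
  have h1 := (abscissa_le_iff hx ha (meets_right hb)).1 (hay.1.trans hby.2)
  have h2 := (abscissa_le_iff hx hb (meets_right ha)).1 (hby.1.trans hay.2)
  have h3 := left_le_right ha
  have h4 := left_le_right hb
  have key : ∀ c, C.Meets c r →
      C.left c r ∈ Icc (C.left a r) (C.left (C.right a) r) →
      C.left c r ∈ Icc (C.left b r) (C.left (C.right b) r) →
      ∃ w, (w = C.lo a ∨ w = C.hi a) ∧ (w = C.lo b ∨ w = C.hi b) ∧ r = C.row w ∧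
        C.abscissa x c r = x w := by
    intro c hc hca hcb
    obtain ⟨w, hwa, hwb, rfl, hw⟩ := exists_common hab (Icc_subset_rowSlice ha hca)
      (Icc_subset_rowSlice hb hcb)
    refine ⟨w, hwa, hwb, rfl, ?_⟩
    rw [← abscissa_const x w]
    exact abscissa_eq_abscissa x hc (meets_const.2 rfl) (by rw [hw, left_const])
  obtain ⟨w, hwa, hwb, rfl, hw⟩ : ∃ w, (w = C.lo a ∨ w = C.hi a) ∧ (w = C.lo b ∨ w = C.hi b) ∧
      r = C.row w ∧ x w ≤ y := by
    rcases le_total (C.left a r) (C.left b r) with h | h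
    · obtain ⟨w, h5, h6, h7, h8⟩ := key b hb ⟨h, h2⟩ ⟨le_rfl, h4⟩
      exact ⟨w, h5, h6, h7, h8 ▸ hby.1⟩
    · obtain ⟨w, h5, h6, h7, h8⟩ := key a ha ⟨le_rfl, h3⟩ ⟨h, h1⟩
      exact ⟨w, h5, h6, h7, h8 ▸ hay.1⟩
  obtain ⟨w', hwa', hwb', -, hw'⟩ : ∃ w', (w' = C.lo a ∨ w' = C.hi a) ∧
      (w' = C.lo b ∨ w' = C.hi b) ∧ C.row w = C.row w' ∧ y ≤ x w' := by
    rcases le_total (C.left (C.right a) (C.row w)) (C.left (C.right b) (C.row w)) with h | h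
    · obtain ⟨w', h5, h6, h7, h8⟩ := key _ (meets_right ha) ⟨h3, le_rfl⟩ ⟨h2, h⟩
      exact ⟨w', h5, h6, h7, h8 ▸ hay.2⟩
    · obtain ⟨w', h5, h6, h7, h8⟩ := key _ (meets_right hb) ⟨h1, h⟩ ⟨h4, le_rfl⟩
      exact ⟨w', h5, h6, h7, h8 ▸ hby.2⟩
  obtain rfl := C.eq_of_mem_ends a b hab w w' hwa hwb hwa' hwb'
  exact ⟨w, hwa, hwb, rfl, le_antisymm hw' hw⟩

theorem abscissa_lt_strip {a b : A} {r : ℤ} (ha : C.Meets a r) (ha' : C.Meets a (r + 1))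
    (hb : C.Meets b r) (hb' : C.Meets b (r + 1))
    (h : C.left a r < C.left b r ∨ C.left a (r + 1) < C.left b (r + 1)) {t : ℝ} (h0 : 0 < t)
    (h1 : t < 1) : C.abscissa x a (r + t) < C.abscissa x b (r + t) := by
  have hle : C.left a r ≤ C.left b r := by
    by_contra! h'
    exact h.elim h'.not_gt (left_noncrossing hb hb' ha ha' h').not_gt
  have hle' : C.left a (r + 1) ≤ C.left b (r + 1) := by
    rcases hle.eq_or_lt with h' | h'
    · exact (h.resolve_left h'.not_lt).le
    · exact left_noncrossing ha ha' hb hb' h'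
  have h2 := (abscissa_le_iff hx ha hb).2 hle
  have h3 := (abscissa_le_iff hx ha' hb').2 hle'
  have h4 : C.abscissa x a r < C.abscissa x b r ∨
      C.abscissa x a (r + 1 : ℤ) < C.abscissa x b (r + 1 : ℤ) :=
    h.imp (hx a b r ha hb) (hx a b _ ha' hb')
  push_cast at h3 h4
  rw [abscissa_interpolate x a, abscissa_interpolate x b]
  rcases h4 with h4 | h4
  · have := mul_lt_mul_of_pos_left h4 (sub_pos.2 h1)
    have := mul_le_mul_of_nonneg_left h3 h0.le
    linarith
  · have := mul_le_mul_of_nonneg_left h2 (sub_pos.2 h1).le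
    have := mul_lt_mul_of_pos_left h4 h0
    linarith

theorem straight_common {a b : A} (hab : a ≠ b) {p : Pt}
    (ha : p ∈ C.straight x a) (hb : p ∈ C.straight x b) :
    ∃ w, (w = C.lo a ∨ w = C.hi a) ∧ (w = C.lo b ∨ w = C.hi b) ∧ p = (x w, (C.row w : ℝ)) := by
  obtain ⟨y, t⟩ := p
  by_cases ht : ∃ r : ℤ, t = r
  · obtain ⟨r, rfl⟩ := ht
    obtain ⟨w, h1, h2, rfl, rfl⟩ := straight_common_row hx hab ha hb
    exact ⟨w, h1, h2, rfl⟩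
  · push Not at ht
    exfalso
    obtain ⟨hma, hma', rfl⟩ := mem_straight_of_notInt ht ha
    obtain ⟨hmb, hmb', hy⟩ := mem_straight_of_notInt ht hb
    have h1 : (0 : ℝ) < Int.fract t := (Int.fract_nonneg t).lt_of_ne fun h =>
      ht ⌊t⌋ (by linarith [Int.floor_add_fract t])
    have h2 := Int.fract_lt_one t
    rw [← Int.floor_add_fract t] at hy
    simp only [Int.floor_add_fract] at hy
    rcases lt_trichotomy (C.left a ⌊t⌋) (C.left b ⌊t⌋) with h | h | h
    · exact (abscissa_lt_strip hx hma hma' hmb hmb' (Or.inl h) h1 h2).ne (by simpa using hy)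
    · rcases lt_trichotomy (C.left a (⌊t⌋ + 1)) (C.left b (⌊t⌋ + 1)) with h' | h' | h'
      · exact (abscissa_lt_strip hx hma hma' hmb hmb' (Or.inr h') h1 h2).ne (by simpa using hy)
      · obtain ⟨w, hwa, hwb, hw, -⟩ := exists_common hab (left_mem hma) (h ▸ left_mem hmb)
        obtain ⟨w', hwa', hwb', hw', -⟩ := exists_common hab (left_mem hma') (h' ▸ left_mem hmb')
        have := C.eq_of_mem_ends a b hab w w' hwa hwb hwa' hwb'
        rw [this] at hw
        omega
      · exact (abscissa_lt_strip hx hmb hmb' hma hma' (Or.inr h') h1 h2).ne' (by simpa using hy)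
    · exact (abscissa_lt_strip hx hmb hmb' hma hma' (Or.inl h) h1 h2).ne' (by simpa using hy)

theorem sameRowOrder_straight : SameRowOrder C.curve (C.straight x) := by
  rintro r a b ⟨y, hy⟩ - ⟨z, hz⟩ ⟨z', hz'⟩
  have ha := ((mem_straight_row hx).1 hz).1
  have hb := ((mem_straight_row hx).1 hz').1
  have hra := (abscissa_le_iff hx ha (meets_right ha)).2 (left_le_right ha)
  have hrb := (abscissa_le_iff hx hb (meets_right hb)).2 (left_le_right hb)
  constructor
  · intro h u hu v hv
    have := hx _ _ r (meets_right ha) hb (h _ (right_mem ha) _ (left_mem hb))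
    exact (((mem_straight_row hx).1 hu).2.2.trans_lt this).trans_le
      ((mem_straight_row hx).1 hv).2.1
  · intro h
    have hab : a ≠ b := by
      rintro rfl
      exact lt_irrefl z (h z hz z hz)
    refine lt_of_right_lt hab ha hb ((abscissa_lt_iff hx (meets_right ha) hb).1 ?_)
    exact h _ ((mem_straight_row hx).2 ⟨ha, hra, le_rfl⟩) _
      ((mem_straight_row hx).2 ⟨hb, le_rfl, hrb⟩)

end Straight

end CurveSystem

namespace PolyDrawing

variable {V : Type} {G : SimpleGraph V} {Γ : PolyDrawing G}

theorem exists_isAscending_edgePts {row : V → ℤ} (hrow : ∀ v, (Γ.pos v).2 = row v)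
    (hmono : Γ.IsYMonotone) {u v : V} (huv : G.Adj u v)
    (hbend : ∀ p ∈ chainBends (Γ.arc s(u, v)), ∃ k : ℤ, p.2 = k) :
    (IsAscending (Γ.edgePts s(u, v)) (row u) (row v) ∨
      IsAscending (Γ.edgePts s(u, v)) (row v) (row u)) ∧
      Γ.pos u ∈ Γ.edgePts s(u, v) ∧ Γ.pos v ∈ Γ.edgePts s(u, v) := by
  have key : ∀ (l : List Pt) (u v : V), l.head? = some (Γ.pos u) → l.getLast? = some (Γ.pos v) →
      (∀ p ∈ chainBends l, ∃ k : ℤ, p.2 = k) →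
      (List.IsChain (· ≤ ·) (l.map Prod.snd) ∨ List.IsChain (· ≥ ·) (l.map Prod.snd)) →
      (IsAscending (chainSet l) (row u) (row v) ∨ IsAscending (chainSet l) (row v) (row u)) ∧
        Γ.pos u ∈ chainSet l ∧ Γ.pos v ∈ chainSet l := by
    intro l u v hu hv hb hl
    cases l with
    | nil => simp at hu
    | cons p l =>
      obtain rfl : p = Γ.pos u := by simpa using hu
      have hlast : (Γ.pos u :: l).getLast (List.cons_ne_nil _ l) = Γ.pos v := by
        rwa [List.getLast?_eq_getLast_of_ne_nil (List.cons_ne_nil _ l), Option.some_inj] at hv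
      have hrows : ∀ q ∈ Γ.pos u :: l, ∃ k : ℤ, q.2 = k := by
        intro q hq
        rcases List.mem_cons.1 hq with rfl | hq
        · exact ⟨_, hrow u⟩
        · have hne := List.ne_nil_of_mem hq
          rw [List.getLast_cons hne] at hlast
          rw [← List.dropLast_append_getLast hne, hlast, List.mem_append, List.mem_singleton] at hq
          rcases hq with hq | rfl
          · exact hb q hq
          · exact ⟨_, hrow v⟩
      refine ⟨?_, mem_chainSet_head _ l, hlast ▸ mem_chainSet_getLast _ l⟩
      refine hl.imp (fun h => ?_) fun h => ?_
      · obtain ⟨m, n, hm, hn, hasc⟩ := isAscending_chainSet _ l hrows h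
        rw [hlast, hrow] at hn
        rw [hrow] at hm
        rwa [Int.cast_injective hm, Int.cast_injective hn]
      · obtain ⟨m, n, hm, hn, hasc⟩ := isAscending_chainSet_of_ge _ l hrows h
        rw [hlast, hrow] at hn
        rw [hrow] at hm
        rwa [Int.cast_injective hm, Int.cast_injective hn]
  rcases Γ.arc_ends u v huv with ⟨h1, h2⟩ | ⟨h1, h2⟩
  · exact key _ u v h1 h2 hbend (hmono _ huv)
  · obtain ⟨h3, h4, h5⟩ := key _ v u h1 h2 hbend (hmono _ huv)
    exact ⟨h3.symm, h5, h4⟩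

theorem exists_curveSystem {row : V → ℤ} (hrow : ∀ v, (Γ.pos v).2 = row v) (hpl : Γ.IsPlanar)
    (hmono : Γ.IsYMonotone)
    (hbend : ∀ e ∈ G.edgeSet, ∀ p ∈ chainBends (Γ.arc e), ∃ k : ℤ, p.2 = k) :
    ∃ C : CurveSystem V (V ⊕ ↥G.edgeSet), C.row = row ∧ C.curve = Γ.drawSet ∧
      (∀ v, C.lo (Sum.inl v) = v ∧ C.hi (Sum.inl v) = v) ∧
      ∀ e : ↥G.edgeSet, (e : Sym2 V) = s(C.lo (Sum.inr e), C.hi (Sum.inr e)) := by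
  have hends : ∀ a : V ⊕ ↥G.edgeSet, ∃ lo hi : V, IsAscending (Γ.drawSet a) (row lo) (row hi) ∧
      Γ.pos lo ∈ Γ.drawSet a ∧ Γ.pos hi ∈ Γ.drawSet a ∧
      (row lo = row hi → (Γ.pos lo).1 ≤ (Γ.pos hi).1) ∧
      (∀ v, a = Sum.inl v → lo = v ∧ hi = v) ∧
      ∀ e : ↥G.edgeSet, a = Sum.inr e → (e : Sym2 V) = s(lo, hi) := by
    rintro (v | ⟨e, he⟩)
    · exact ⟨v, v, isAscending_singleton (hrow v), rfl, rfl, fun _ => le_rfl, by simp, by simp⟩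
    · induction e using Sym2.ind with
      | _ u v =>
        obtain ⟨h1, h2, h3⟩ := exists_isAscending_edgePts hrow hmono he (hbend _ he)
        by_cases huv : row u = row v ∧ (Γ.pos v).1 ≤ (Γ.pos u).1
        · refine ⟨v, u, ?_, h3, h2, fun _ => huv.2, by simp, ?_⟩
          · rw [huv.1] at h1 ⊢
            exact h1.elim id id
          · rintro e h
            rw [← Sum.inr_injective h]
            exact Sym2.eq_swap
        · rcases h1 with h1 | h1
          · refine ⟨u, v, h1, h2, h3, fun h => ?_, by simp, ?_⟩
            · exact (not_le.1 fun h' => huv ⟨h, h'⟩).le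
            · rintro e h
              rw [← Sum.inr_injective h]
          · by_cases h' : row v = row u
            · refine ⟨u, v, ?_, h2, h3, fun h => ?_, by simp, ?_⟩
              · rw [h'] at h1 ⊢
                exact h1
              · exact (not_le.1 fun h' => huv ⟨h, h'⟩).le
              · rintro e h
                rw [← Sum.inr_injective h]
            · refine ⟨v, u, h1, h3, h2, fun h => absurd h h', by simp, ?_⟩
              rintro e h
              rw [← Sum.inr_injective h]
              exact Sym2.eq_swap
  choose lo hi hasc hlo hhi hle hvert hedge using hends
  have hlo_inl : ∀ v, lo (Sum.inl v) = v := fun v => (hvert _ v rfl).1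
  have hhi_inl : ∀ v, hi (Sum.inl v) = v := fun v => (hvert _ v rfl).2
  have hmem : ∀ w (e : ↥G.edgeSet), (w = lo (Sum.inr e) ∨ w = hi (Sum.inr e)) ↔ w ∈ (e : Sym2 V) :=
    fun w e => by rw [hedge _ e rfl, Sym2.mem_iff]
  refine ⟨{
    pos := Γ.pos
    pos_inj := Γ.pos_inj
    row := row
    pos_snd := hrow
    lo := lo
    hi := hi
    curve := Γ.drawSet
    isAscending := hasc
    lo_mem := hlo
    hi_mem := hhi
    fst_le := hle
    const := Sum.inl
    lo_const := hlo_inl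
    hi_const := hhi_inl
    common := ?_
    eq_of_mem_ends := ?_ }, rfl, rfl, fun v => hvert _ v rfl, fun e => hedge _ e rfl⟩
  · rintro (v | e) (v' | f) hab p ⟨hp, hp'⟩
    · refine absurd (congrArg Sum.inl (Γ.pos_inj ?_)) hab
      exact (Set.mem_singleton_iff.1 hp).symm.trans (Set.mem_singleton_iff.1 hp')
    · obtain rfl : p = Γ.pos v := hp
      refine ⟨v, Or.inl (hlo_inl v).symm, (hmem v f).2 ?_, rfl⟩
      by_contra h
      exact hpl.1 v f f.2 h hp'
    · obtain rfl : p = Γ.pos v' := hp'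
      refine ⟨v', (hmem v' e).2 ?_, Or.inl (hlo_inl v').symm, rfl⟩
      by_contra h
      exact hpl.1 v' e e.2 h hp
    · obtain ⟨w, h1, h2, h3⟩ := hpl.2 e e.2 f f.2
        (fun h => hab (congrArg Sum.inr (Subtype.ext h))) p ⟨hp, hp'⟩
      exact ⟨w, (hmem w e).2 h1, (hmem w f).2 h2, h3⟩
  · intro a b hab w w' hwa hwb hwa' hwb'
    rcases a with v | e
    · simp only [hlo_inl, hhi_inl, or_self] at hwa hwa'
      rw [hwa, hwa']
    rcases b with v | f
    · simp only [hlo_inl, hhi_inl, or_self] at hwb hwb'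
      rw [hwb, hwb']
    rw [hmem] at hwa hwb hwa' hwb'
    by_contra hne
    refine hab (congrArg Sum.inr (Subtype.ext ?_))
    rw [(Sym2.mem_and_mem_iff hne).1 ⟨hwa, hwa'⟩, (Sym2.mem_and_mem_iff hne).1 ⟨hwb, hwb'⟩]

end PolyDrawing

/-- Any planar `y`-monotone poly-line drawing of height `h` can be
straightened out: there is a planar straight-line drawing with the same `y`-coordinates
of vertices and the same left-to-right order in each row; in particular it also has
height `h`. -/
theorem stmt0 {V : Type} [Fintype V] (G : SimpleGraph V) (h : ℕ)
    (Γ : PolyDrawing G) (hpl : Γ.IsPlanar) (hmono : Γ.IsYMonotone)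
    (hht : Γ.HasHeight h) :
    ∃ Γ' : StraightDrawing G, Γ'.IsPlanar ∧
      (∀ v : V, (Γ'.pos v).2 = (Γ.pos v).2) ∧
      SameRowOrder Γ.drawSet Γ'.drawSet ∧
      Γ'.HeightLe h := by
  choose row hrow using hht.1
  obtain ⟨C, rfl, hcurve, hvert, hedge⟩ := PolyDrawing.exists_curveSystem
    (fun v => (hrow v).2.2) hpl hmono fun e he p hp => (hht.2 e he p hp).imp fun _ hk => hk.2.2
  obtain ⟨x, hx⟩ := C.exists_abscissa_lt
  have hlo : ∀ v, C.lo (Sum.inl v) = v := fun v => (hvert v).1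
  have hhi : ∀ v, C.hi (Sum.inl v) = v := fun v => (hvert v).2
  let Γ' : StraightDrawing G :=
    { pos := fun v => (x v, (C.row v : ℝ))
      pos_inj := fun v w hvw => by
        by_contra hne
        obtain ⟨u, h1, h2, -⟩ := CurveSystem.straight_common (C := C) hx
          (fun h => hne (Sum.inl_injective h)) (a := Sum.inl v) (b := Sum.inl w)
          (p := (x v, (C.row v : ℝ))) (by simp [CurveSystem.straight, hlo, hhi])
          (by simpa [CurveSystem.straight, hlo, hhi] using hvw)
        simp only [hlo, hhi, or_self] at h1 h2
        exact hne (h1.symm.trans h2) }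
  have hdraw : Γ'.drawSet = C.straight x := by
    funext a
    rcases a with v | e
    · simp [StraightDrawing.drawSet, CurveSystem.straight, hlo, hhi, Γ']
    · simp only [StraightDrawing.drawSet]
      rw [hedge e]
      rfl
  have hmem : ∀ w (e : ↥G.edgeSet), (w = C.lo (Sum.inr e) ∨ w = C.hi (Sum.inr e)) →
      w ∈ (e : Sym2 V) := fun w e hw => by rwa [hedge e, Sym2.mem_iff]
  refine ⟨Γ', ⟨fun v e he hve hp => ?_, fun e he f hf hef p hp => ?_⟩,
    fun v => (hrow v).2.2.symm, ?_, fun v => ⟨C.row v, (hrow v).1, (hrow v).2.1, rfl⟩⟩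
  · have h1 : Γ'.pos v ∈ C.straight x (Sum.inl v) := hdraw ▸ rfl
    have h2 : Γ'.pos v ∈ C.straight x (Sum.inr ⟨e, he⟩) := hdraw ▸ hp
    obtain ⟨w, h3, h4, -⟩ := CurveSystem.straight_common hx Sum.inl_ne_inr h1 h2
    rw [hlo, hhi, or_self] at h3
    exact hve (h3 ▸ hmem w _ h4)
  · have h1 : p ∈ C.straight x (Sum.inr ⟨e, he⟩) := hdraw ▸ hp.1
    have h2 : p ∈ C.straight x (Sum.inr ⟨f, hf⟩) := hdraw ▸ hp.2
    obtain ⟨w, h3, h4, h5⟩ := CurveSystem.straight_common hx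
      (fun h => hef (congrArg Subtype.val (Sum.inr_injective h))) h1 h2
    exact ⟨w, hmem w _ h3, hmem w _ h4, h5⟩
  · rw [← hcurve, hdraw]
    exact CurveSystem.sameRowOrder_straight hx
end

section
/- Let Γ be a planar y-monotone poly-line drawing of a triangulated simple graph G. Then every inner vertex v of Γ satisfies indeg(v) ≥ 1 and outdeg(v) ≥ 1; equivalently, every inner vertex v has a neighbour w with y(w) ≤ y(v) and a neighbour w′ with y(w′) ≥ y(v). -/
open Set

/-- The row-by-row data of a `y`-monotone planar drawing of `G`: vertex coordinates and, for each
edge `e` and height `t`, the set `S e t` of `x`-coordinates at which `e` meets the line `y = t`. -/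
structure RowDrawing {V : Type} (G : SimpleGraph V) where
  X : V → ℝ
  Y : V → ℝ
  S : Sym2 V → ℝ → Set ℝ
  inj : ∀ u v, X u = X v → Y u = Y v → u = v
  ordConnected : ∀ e ∈ G.edgeSet, ∀ t, (S e t).OrdConnected
  nonempty : ∀ u w, G.Adj u w → ∀ t ∈ uIcc (Y u) (Y w), (S s(u, w) t).Nonempty
  range : ∀ u w, G.Adj u w → ∀ t, (S s(u, w) t).Nonempty → t ∈ uIcc (Y u) (Y w)
  mem_iff : ∀ e ∈ G.edgeSet, ∀ z, X z ∈ S e (Y z) ↔ z ∈ e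
  meet : ∀ e ∈ G.edgeSet, ∀ f ∈ G.edgeSet, e ≠ f → ∀ t, ∀ x ∈ S e t, x ∈ S f t →
    ∃ z, z ∈ e ∧ z ∈ f ∧ x = X z ∧ t = Y z
  order : ∀ e ∈ G.edgeSet, ∀ f ∈ G.edgeSet, ∀ s t,
    (∀ r ∈ uIcc s t, (S e r).Nonempty ∧ (S f r).Nonempty ∧ Disjoint (S e r) (S f r)) →
    ∀ a ∈ S e s, ∀ b ∈ S f s, a < b → ∀ a' ∈ S e t, ∀ b' ∈ S f t, a' < b'

namespace RowDrawing

variable {V : Type} {G : SimpleGraph V}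

/-- Reflection in the `y`-axis. -/
def flipX (R : RowDrawing G) : RowDrawing G where
  X v := -R.X v
  Y := R.Y
  S e t := -R.S e t
  inj u v h := R.inj u v (neg_injective h)
  ordConnected e he t := by
    refine ⟨fun x hx y hy z hz => ?_⟩
    exact (R.ordConnected e he t).out hy hx ⟨neg_le_neg hz.2, neg_le_neg hz.1⟩
  nonempty u w h t ht := (R.nonempty u w h t ht).neg
  range u w h t ht := R.range u w h t (by simpa using ht.neg)
  mem_iff e he z := by simpa using R.mem_iff e he z
  meet e he f hf hne t x hx hx' := by
    obtain ⟨z, h1, h2, h3, h4⟩ := R.meet e he f hf hne t (-x) hx hx'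
    exact ⟨z, h1, h2, by linarith, h4⟩
  order e he f hf s t h a ha b hb hab a' ha' b' hb' := by
    have := R.order f hf e he s t (fun r hr => ?_) (-b) hb (-a) ha (by linarith)
      (-b') hb' (-a') ha'
    · linarith
    · obtain ⟨h1, h2, h3⟩ := h r hr
      refine ⟨by simpa using h2.neg, by simpa using h1.neg, ?_⟩
      rw [Set.disjoint_left] at h3 ⊢
      intro x hx hx'
      exact h3 (a := -x) (by simpa using hx') (by simpa using hx)

/-- Reflection in the `x`-axis. -/
def flipY (R : RowDrawing G) : RowDrawing G where
  X := R.X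
  Y v := -R.Y v
  S e t := R.S e (-t)
  inj u v h h' := R.inj u v h (neg_injective h')
  ordConnected e he t := R.ordConnected e he _
  nonempty u w h t ht := R.nonempty u w h _ (by
    rw [mem_uIcc] at ht ⊢; rcases ht with ⟨h1, h2⟩ | ⟨h1, h2⟩
    · exact Or.inr ⟨by linarith, by linarith⟩
    · exact Or.inl ⟨by linarith, by linarith⟩)
  range u w h t ht := by
    have := R.range u w h _ ht
    rw [mem_uIcc] at this ⊢; rcases this with ⟨h1, h2⟩ | ⟨h1, h2⟩
    · exact Or.inr ⟨by linarith, by linarith⟩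
    · exact Or.inl ⟨by linarith, by linarith⟩
  mem_iff e he z := by simpa using R.mem_iff e he z
  meet e he f hf hne t x hx hx' := by
    obtain ⟨z, h1, h2, h3, h4⟩ := R.meet e he f hf hne _ x hx hx'
    exact ⟨z, h1, h2, h3, by linarith⟩
  order e he f hf s t h := R.order e he f hf (-s) (-t) (fun r hr => by
    have := h (-r) (by
      rw [mem_uIcc] at hr ⊢; rcases hr with ⟨h1, h2⟩ | ⟨h1, h2⟩
      · exact Or.inr ⟨by linarith, by linarith⟩
      · exact Or.inl ⟨by linarith, by linarith⟩)
    simpa using this)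

/-- Nothing of the drawing lies to the left of `x` in the row of `x`, except possibly
parts of edges incident to `x`. -/
def LeftVis (R : RowDrawing G) (x : V) : Prop :=
  (∀ z, R.Y z = R.Y x → R.X x ≤ R.X z) ∧
  ∀ e ∈ G.edgeSet, x ∉ e → ∀ b ∈ R.S e (R.Y x), R.X x ≤ b

lemma flipY_leftVis (R : RowDrawing G) (x : V) : R.flipY.LeftVis x ↔ R.LeftVis x := by
  simp [LeftVis, flipY]

variable (R : RowDrawing G)

lemma fst_mem {u w : V} (h : G.Adj u w) : R.X u ∈ R.S s(u, w) (R.Y u) :=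
  (R.mem_iff _ h u).2 (by simp)

lemma snd_mem {u w : V} (h : G.Adj u w) : R.X w ∈ R.S s(u, w) (R.Y w) :=
  (R.mem_iff _ h w).2 (by simp)

lemma disjoint {e f : Sym2 V} (he : e ∈ G.edgeSet) (hf : f ∈ G.edgeSet) (hne : e ≠ f) {r : ℝ}
    (h : ∀ z, z ∈ e → z ∈ f → R.Y z ≠ r) : Disjoint (R.S e r) (R.S f r) := by
  rw [Set.disjoint_left]
  intro x hx hx'
  obtain ⟨z, h1, h2, -, h4⟩ := R.meet e he f hf hne r x hx hx'
  exact h z h1 h2 h4.symm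

/-- Two edges present in all rows between `s` and `t` that share no vertex there keep their
left-to-right order. -/
lemma transport {u w u' w' : V} (h : G.Adj u w) (h' : G.Adj u' w') (hne : s(u, w) ≠ s(u', w'))
    {s t : ℝ} (hs : s ∈ Icc (R.Y u) (R.Y w)) (ht : t ∈ Icc (R.Y u) (R.Y w))
    (hs' : s ∈ Icc (R.Y u') (R.Y w')) (ht' : t ∈ Icc (R.Y u') (R.Y w'))
    (hdis : ∀ z, (z = u ∨ z = w) → (z = u' ∨ z = w') → R.Y z ∉ uIcc s t)
    {a b : ℝ} (ha : a ∈ R.S s(u, w) s) (hb : b ∈ R.S s(u', w') s) (hab : a < b) :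
    ∀ a' ∈ R.S s(u, w) t, ∀ b' ∈ R.S s(u', w') t, a' < b' := by
  refine R.order _ h _ h' s t (fun r hr => ⟨?_, ?_, ?_⟩) a ha b hb hab
  · exact R.nonempty _ _ h _ (Icc_subset_uIcc (Set.uIcc_subset_Icc hs ht hr))
  · exact R.nonempty _ _ h' _ (Icc_subset_uIcc (Set.uIcc_subset_Icc hs' ht' hr))
  · refine R.disjoint h h' hne fun z hz hz' hr' => ?_
    exact hdis z (by simpa using hz) (by simpa using hz') (hr' ▸ hr)

lemma lt_X {e : Sym2 V} (he : e ∈ G.edgeSet) {z : V} (hz : z ∉ e) {a : ℝ}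
    (ha : a ∈ R.S e (R.Y z)) (h : a < R.X z) : ∀ b ∈ R.S e (R.Y z), b < R.X z := by
  intro b hb
  by_contra! hzb
  exact hz ((R.mem_iff _ he z).1 ((R.ordConnected _ he _).out ha hb ⟨h.le, hzb⟩))

lemma exists_through {x : V} (hx : ∀ z, R.Y z = R.Y x → R.X x ≤ R.X z) (hnv : ¬ R.LeftVis x) :
    ∃ p q, G.Adj p q ∧ R.Y p < R.Y x ∧ R.Y x < R.Y q ∧ ∃ b ∈ R.S s(p, q) (R.Y x), b < R.X x := by
  simp only [LeftVis, not_and, not_forall, not_le] at hnv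
  obtain ⟨e, he, hxe, b, hb, hbx⟩ := hnv hx
  induction e with | _ p q
  have hpq : G.Adj p q := he
  have hend : ∀ z ∈ s(p, q), R.Y z ≠ R.Y x := by
    intro z hz hzY
    have hzm : R.X z ∈ R.S s(p, q) (R.Y x) := hzY ▸ (R.mem_iff _ he z).2 hz
    exact hxe ((R.mem_iff _ he x).1 ((R.ordConnected _ he _).out hb hzm ⟨hbx.le, hx z hzY⟩))
  have hr := R.range p q hpq _ ⟨b, hb⟩
  have hp := hend p (by simp)
  have hq := hend q (by simp)
  rcases mem_uIcc.1 hr with ⟨h1, h2⟩ | ⟨h1, h2⟩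
  · exact ⟨p, q, hpq, lt_of_le_of_ne h1 hp, lt_of_le_of_ne h2 hq.symm, b, hb, hbx⟩
  · exact ⟨q, p, hpq.symm, lt_of_le_of_ne h1 hq, lt_of_le_of_ne h2 hp.symm, b,
      by rwa [Sym2.eq_swap], hbx⟩

variable [Fintype V]

lemma exists_lex_min (P : V → Prop) (hP : ∃ v, P v) :
    ∃ z, P z ∧ ∀ z', P z' → R.Y z < R.Y z' ∨ (R.Y z = R.Y z' ∧ R.X z ≤ R.X z') := by
  classical
  obtain ⟨z, hz, hmin⟩ := Finset.exists_min_image (Finset.univ.filter P)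
    (fun z => toLex (R.Y z, R.X z)) (by obtain ⟨v, hv⟩ := hP; exact ⟨v, by simpa using hv⟩)
  refine ⟨z, by simpa using hz, fun z' hz' => ?_⟩
  simpa [Prod.Lex.le_iff] using hmin z' (by simpa using hz')

/-- If no vertex strictly between the lowest and the highest row is left-visible, then the
leftmost edge through such a row ends in the highest row. -/
lemma leftmost_upper {m M : ℝ} (hM : ∀ z, R.Y z ≤ M)
    (hvis : ∀ z, m < R.Y z → R.Y z < M → ¬ R.LeftVis z) {p q : V} {t : ℝ} (hpq : G.Adj p q)
    (hmt : m < t) (hpt : R.Y p < t) (htq : t < R.Y q)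
    (hv : ∀ z, R.Y z = t → ∀ a ∈ R.S s(p, q) t, a < R.X z)
    (he : ∀ p' q', G.Adj p' q' → s(p', q') ≠ s(p, q) → R.Y p' < t → t < R.Y q' →
      ∀ a ∈ R.S s(p, q) t, ∀ b ∈ R.S s(p', q') t, a ≤ b) :
    R.Y q = M := by
  by_contra hqM
  have hqM := lt_of_le_of_ne (hM q) hqM
  obtain ⟨z, ⟨htz, hzq, a, ha, hza⟩, hmin⟩ := R.exists_lex_min
    (fun z => t < R.Y z ∧ R.Y z ≤ R.Y q ∧ ∃ a ∈ R.S s(p, q) (R.Y z), R.X z ≤ a)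
    ⟨q, htq, le_rfl, R.X q, R.snd_mem hpq, le_rfl⟩
  have hleft : ∀ z', R.Y z' = R.Y z → R.X z ≤ R.X z' := by
    intro z' hz'
    by_contra! hlt
    rcases hmin z' ⟨hz' ▸ htz, hz' ▸ hzq, a, hz' ▸ ha, hlt.le.trans hza⟩ with h | h
    · linarith
    · linarith [h.2]
  obtain ⟨p', q', hpq', h1, h2, b, hb, hbz⟩ :=
    R.exists_through hleft (hvis z (hmt.trans htz) (hzq.trans_lt hqM))
  have hne : s(p', q') ≠ s(p, q) := by
    intro h
    have := (R.mem_iff _ hpq z).1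
      ((R.ordConnected _ hpq _).out (h ▸ hb) ha ⟨hbz.le, hza⟩)
    rw [← h, Sym2.mem_iff] at this
    rcases this with rfl | rfl
    · exact lt_irrefl _ h1
    · exact lt_irrefl _ h2
  have key : ∀ s, R.Y p' ≤ s → t ≤ s → s < R.Y z →
      ∀ b' ∈ R.S s(p', q') s, ∀ a' ∈ R.S s(p, q) s, b' < a' := by
    intro s hs hts hsz
    refine R.transport hpq' hpq hne (s := R.Y z) ⟨h1.le, h2.le⟩ ⟨hs, hsz.le.trans h2.le⟩
      ⟨by linarith, hzq⟩ ⟨by linarith, by linarith⟩ ?_ hb ha (hbz.trans_le hza)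
    intro x hx hx' hmem
    rw [uIcc_of_ge hsz.le] at hmem
    rcases hx with rfl | rfl
    · rcases hx' with rfl | rfl
      · linarith [hmem.1]
      · linarith [hmem.1]
    · linarith [hmem.2]
  rcases lt_or_ge t (R.Y p') with h | h
  · obtain ⟨a', ha'⟩ := R.nonempty p q hpq (R.Y p') (Icc_subset_uIcc ⟨by linarith, by linarith⟩)
    have := key (R.Y p') le_rfl h.le h1 _ (R.fst_mem hpq') a' ha'
    rcases hmin p' ⟨h, by linarith, a', ha', this.le⟩ with h | h <;> linarith
  · obtain ⟨a', ha'⟩ := R.nonempty p q hpq t (Icc_subset_uIcc ⟨by linarith, by linarith⟩)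
    obtain ⟨b', hb'⟩ := R.nonempty p' q' hpq' t (Icc_subset_uIcc ⟨by linarith, by linarith⟩)
    have hlt := key t h le_rfl htz b' hb' a' ha'
    rcases h.eq_or_lt with h | h
    · have h3 := key t h.le le_rfl htz (R.X p') (h ▸ R.fst_mem hpq') a' ha'
      exact lt_asymm h3 (hv p' h a' ha')
    · exact (he p' q' hpq' hne h (htz.trans h2) a' ha' b' hb').not_gt hlt

/-- If no vertex strictly between the lowest and the highest row is left-visible, then some edge
from the lowest to the highest row passes to the left of any given vertex between these rows. -/
lemma exists_left_edge {m M : ℝ} (hm : ∀ z, m ≤ R.Y z) (hM : ∀ z, R.Y z ≤ M)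
    (hvis : ∀ z, m < R.Y z → R.Y z < M → ¬ R.LeftVis z) {v : V} (hmv : m < R.Y v)
    (hvM : R.Y v < M) :
    ∃ p q, G.Adj p q ∧ R.Y p = m ∧ R.Y q = M ∧ ∃ a ∈ R.S s(p, q) (R.Y v), a < R.X v := by
  classical
  obtain ⟨x, hxv, hxmin⟩ := Finset.exists_min_image (Finset.univ.filter (R.Y · = R.Y v)) R.X
    ⟨v, by simp⟩
  simp only [Finset.mem_filter, Finset.mem_univ, true_and] at hxv hxmin
  obtain ⟨p₀, q₀, hpq₀, h1, h2, b, hb, hbx⟩ := R.exists_through (x := x)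
    (fun z hz => hxmin z (hz.trans hxv)) (hvis x (hxv ▸ hmv) (hxv ▸ hvM))
  rw [hxv] at h1 h2 hb
  set t := R.Y v
  have hne : ∀ p q, ∃ a, G.Adj p q → R.Y p < t → t < R.Y q → a ∈ R.S s(p, q) t := by
    intro p q
    by_cases h : G.Adj p q ∧ R.Y p < t ∧ t < R.Y q
    · obtain ⟨a, ha⟩ := R.nonempty p q h.1 t (Icc_subset_uIcc ⟨h.2.1.le, h.2.2.le⟩)
      exact ⟨a, fun _ _ _ => ha⟩
    · exact ⟨0, fun h1 h2 h3 => (h ⟨h1, h2, h3⟩).elim⟩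
  choose c hc using hne
  obtain ⟨⟨p, q⟩, hpq, hmin⟩ := Finset.exists_min_image
    (Finset.univ.filter fun e : V × V => G.Adj e.1 e.2 ∧ R.Y e.1 < t ∧ t < R.Y e.2)
    (fun e => c e.1 e.2) ⟨(p₀, q₀), by simpa using ⟨hpq₀, h1, h2⟩⟩
  simp only [Finset.mem_filter, Finset.mem_univ, true_and, Prod.forall] at hpq hmin
  obtain ⟨hadj, hpt, htq⟩ := hpq
  have hends : ∀ {p' q' : V}, R.Y p' < t → t < R.Y q' → ∀ z ∈ s(p', q'), R.Y z ≠ t := by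
    intro p' q' h1 h2 z hz
    rcases Sym2.mem_iff.1 hz with rfl | rfl
    exacts [h1.ne, h2.ne']
  have he : ∀ p' q', G.Adj p' q' → s(p', q') ≠ s(p, q) → R.Y p' < t → t < R.Y q' →
      ∀ a ∈ R.S s(p, q) t, ∀ b ∈ R.S s(p', q') t, a ≤ b := by
    intro p' q' hadj' hs hp' hq' a ha b hb
    by_contra! hba
    have hle := hmin p' q' ⟨hadj', hp', hq'⟩
    have := R.transport hadj' hadj hs (s := t) (t := t) ⟨hp'.le, hq'.le⟩ ⟨hp'.le, hq'.le⟩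
      ⟨hpt.le, htq.le⟩ ⟨hpt.le, htq.le⟩ (fun z hz _ hzt => hends hp' hq' z (by simpa using hz)
        (by simpa using hzt)) hb ha hba _ (hc p' q' hadj' hp' hq') _ (hc p q hadj hpt htq)
    linarith
  have hlt : c p q < R.X x :=
    (hmin p₀ q₀ ⟨hpq₀, h1, h2⟩).trans_lt (R.lt_X hpq₀ (fun h => hends h1 h2 x h hxv)
      (hxv ▸ hb) hbx _ (hxv ▸ hc p₀ q₀ hpq₀ h1 h2))
  have hv : ∀ z, R.Y z = t → ∀ a ∈ R.S s(p, q) t, a < R.X z := by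
    intro z hz a ha
    exact R.lt_X hadj (fun h => hends hpt htq z h hz) (hz ▸ hc p q hadj hpt htq)
      (hlt.trans_le (hxmin z hz)) _ (hz ▸ ha)
  refine ⟨p, q, hadj, ?_, R.leftmost_upper hM hvis hadj hmv hpt htq hv he, c p q,
    hc p q hadj hpt htq, hv v rfl _ (hc p q hadj hpt htq)⟩
  have := R.flipY.leftmost_upper (m := -M) (M := -m) (p := q) (q := p) (t := -t)
    (fun z => neg_le_neg (hm z))
    (fun z h1 h2 => (R.flipY_leftVis z).not.2 (hvis z (neg_lt_neg_iff.1 h2) (neg_lt_neg_iff.1 h1)))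
    hadj.symm (neg_lt_neg hvM) (neg_lt_neg htq) (neg_lt_neg hpt)
    (fun z hz a ha => hv z (neg_injective hz) a (by simpa [flipY, Sym2.eq_swap] using ha))
    (fun p' q' h hs h1 h2 a ha b hb => he q' p' h.symm
      (by rwa [Sym2.eq_swap, Sym2.eq_swap (a := p)])
      (neg_lt_neg_iff.1 h2) (neg_lt_neg_iff.1 h1) a (by simpa [flipY, Sym2.eq_swap] using ha)
      b (by simpa [flipY, Sym2.eq_swap] using hb))
  exact neg_injective this

lemma exists_above (u : V) : ∃ r, R.Y u < r ∧ ∀ w, R.Y u < R.Y w → r < R.Y w := by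
  by_cases h : ∃ w, R.Y u < R.Y w
  · obtain ⟨z, hz, hmin⟩ := R.exists_lex_min _ h
    refine ⟨(R.Y u + R.Y z) / 2, by linarith, fun w hw => ?_⟩
    rcases hmin w hw with h | h <;> linarith
  · exact ⟨R.Y u + 1, by linarith, fun w hw => (h ⟨w, hw⟩).elim⟩

/-- A height slightly above `u`. -/
noncomputable def up (u : V) : ℝ := (R.exists_above u).choose

lemma lt_up (u : V) : R.Y u < R.up u := (R.exists_above u).choose_spec.1

lemma up_lt {u w : V} (h : R.Y u < R.Y w) : R.up u < R.Y w := (R.exists_above u).choose_spec.2 w h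

/-- A point of the edge `uw` slightly above `u`; these order the edges leaving `u` upwards. -/
noncomputable def startX (u w : V) : ℝ := Classical.epsilon (· ∈ R.S s(u, w) (R.up u))

omit [Fintype V] in
lemma nonempty_of_mem {u w : V} (h : G.Adj u w) {t : ℝ} (ht : t ∈ Icc (R.Y u) (R.Y w)) :
    (R.S s(u, w) t).Nonempty := R.nonempty u w h t (Icc_subset_uIcc ht)

/-- `uw` is an edge leaving `u` upwards. -/
def Out (u w : V) : Prop := G.Adj u w ∧ R.Y u < R.Y w

variable {R}

lemma Out.up_mem {u w : V} (h : R.Out u w) : R.up u ∈ Icc (R.Y u) (R.Y w) :=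
  ⟨(R.lt_up u).le, (R.up_lt h.2).le⟩

lemma Out.startX_mem {u w : V} (h : R.Out u w) : R.startX u w ∈ R.S s(u, w) (R.up u) :=
  Classical.epsilon_spec (R.nonempty_of_mem h.1 h.up_mem)

omit [Fintype V] in
lemma Out.ne {u w u' w' : V} (h : R.Out u w) (h' : R.Out u' w') (hne : (u, w) ≠ (u', w')) :
    s(u, w) ≠ s(u', w') := by
  intro he
  rcases Sym2.eq_iff.1 he with ⟨rfl, rfl⟩ | ⟨rfl, rfl⟩
  · exact hne rfl
  · exact lt_asymm h.2 h'.2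

lemma Out.startX_inj {u w w' : V} (h : R.Out u w) (h' : R.Out u w')
    (he : R.startX u w = R.startX u w') : w = w' := by
  by_contra hne
  obtain ⟨z, h1, h2, -, h4⟩ := R.meet _ h.1 _ h'.1 (h.ne h' (by simp [hne])) _ _ h.startX_mem
    (he ▸ h'.startX_mem)
  rcases Sym2.mem_iff.1 h1 with rfl | rfl
  · exact (R.lt_up _).ne' h4
  · exact (R.up_lt h.2).ne h4

variable (R)

/-- The edge `uw'` is the next edge to the right of `uw` among those leaving `u` upwards. -/
structure Next (u w w' : V) : Prop where
  left : R.Out u w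
  right : R.Out u w'
  lt : R.startX u w < R.startX u w'
  le : ∀ w'', R.Out u w'' → R.startX u w < R.startX u w'' → R.startX u w' ≤ R.startX u w''

/-- The vertex `z` lies above `u` in the closed region between the edges `uw` and `uw'`. -/
structure Gap (u w w' z : V) : Prop where
  lt : R.Y u < R.Y z
  le_left : R.Y z ≤ R.Y w
  le_right : R.Y z ≤ R.Y w'
  left : ∃ a ∈ R.S s(u, w) (R.Y z), a ≤ R.X z
  right : ∃ b ∈ R.S s(u, w') (R.Y z), R.X z ≤ b

/-- The vertex `z` is the first vertex, from the bottom and then from the left, in the region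
between the edges `uw` and `uw'`. -/
structure First (u w w' z : V) : Prop where
  gap : R.Gap u w w' z
  min : ∀ z', R.Gap u w w' z' → R.Y z < R.Y z' ∨ (R.Y z = R.Y z' ∧ R.X z ≤ R.X z')

variable {R}

lemma Next.ne {u w w' : V} (h : R.Next u w w') : w ≠ w' := by
  rintro rfl
  exact lt_irrefl _ h.lt

/-- An edge strictly inside the region between two consecutive edges leaving `u` starts at a vertex
of that region. -/
lemma Next.gap_of_between {u w w' p q : V} (h : R.Next u w w') (hpq : R.Out p q) {r : ℝ}
    (hur : R.Y u < r) (hrw : r ≤ R.Y w) (hrw' : r ≤ R.Y w') (hpr : R.Y p < r) (hrq : r ≤ R.Y q)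
    (hne : (u, w) ≠ (p, q)) (hne' : (u, w') ≠ (p, q))
    {a b c : ℝ} (ha : a ∈ R.S s(u, w) r) (hb : b ∈ R.S s(u, w') r) (hc : c ∈ R.S s(p, q) r)
    (hac : a < c) (hcb : c < b)
    (hdis : ∀ z ∈ s(p, q), (z ∈ s(u, w) → R.Y z ≠ r) ∧ (z ∈ s(u, w') → R.Y z ≠ r)) :
    R.Gap u w w' p := by
  have aux : ∀ s, R.Y p ≤ s → R.Y u ≤ s → s ≤ r → (p = u → R.Y u < s) →
      (∀ a ∈ R.S s(u, w) s, ∀ c ∈ R.S s(p, q) s, a < c) ∧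
      (∀ c ∈ R.S s(p, q) s, ∀ b ∈ R.S s(u, w') s, c < b) := by
    intro s hps hus hsr hpu
    have main : ∀ v, R.Y u < R.Y v → r ≤ R.Y v →
        (∀ z ∈ s(p, q), z ∈ s(u, v) → R.Y z ≠ r) →
        ∀ z, (z = u ∨ z = v) → (z = p ∨ z = q) → R.Y z ∉ uIcc r s := by
      intro v huv hrv hd z hz hz' hm
      rw [uIcc_of_ge hsr] at hm
      have h1 := hd z (by simpa using hz') (by simpa using hz)
      have h2 := lt_of_le_of_ne hm.2 h1
      rcases hz with rfl | rfl
      · rcases hz' with rfl | rfl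
        · linarith [hpu rfl, hm.1]
        · linarith
      · linarith
    refine ⟨R.transport h.left.1 hpq.1 (h.left.ne hpq hne) (s := r) ⟨hur.le, hrw⟩
      ⟨hus, hsr.trans hrw⟩ ⟨hpr.le, hrq⟩ ⟨hps, hsr.trans hrq⟩
      (main w h.left.2 hrw fun z hz => (hdis z hz).1) ha hc hac,
      R.transport hpq.1 h.right.1 (hpq.ne h.right hne'.symm) (s := r) ⟨hpr.le, hrq⟩
      ⟨hps, hsr.trans hrq⟩ ⟨hur.le, hrw'⟩ ⟨hus, hsr.trans hrw'⟩
      (fun z hz hz' => main w' h.right.2 hrw' (fun z hz => (hdis z hz).2) z hz' hz) hc hb hcb⟩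
  rcases lt_or_ge (R.Y u) (R.Y p) with hup | hpu
  · obtain ⟨h1, h2⟩ := aux (R.Y p) le_rfl hup.le hpr.le (fun _ => hup)
    obtain ⟨a', ha'⟩ := R.nonempty_of_mem h.left.1 ⟨hup.le, hpr.le.trans hrw⟩
    obtain ⟨b', hb'⟩ := R.nonempty_of_mem h.right.1 ⟨hup.le, hpr.le.trans hrw'⟩
    exact ⟨hup, hpr.le.trans hrw, hpr.le.trans hrw',
      ⟨a', ha', (h1 _ ha' _ (R.fst_mem hpq.1)).le⟩, ⟨b', hb', (h2 _ (R.fst_mem hpq.1) _ hb').le⟩⟩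
  · exfalso
    by_cases hpu' : p = u
    · subst hpu'
      have main : ∀ v v', R.Out p v → R.Out p v' → (p, v) ≠ (p, v') → r ≤ R.Y v → r ≤ R.Y v' →
          ∀ a ∈ R.S s(p, v) r, ∀ b ∈ R.S s(p, v') r, a < b → R.startX p v < R.startX p v' := by
        intro v v' hv hv' hvv hrv hrv' a ha b hb hab
        refine R.transport hv.1 hv'.1 (hv.ne hv' hvv) (s := r) ⟨hpr.le, hrv⟩ hv.up_mem
          ⟨hpr.le, hrv'⟩ hv'.up_mem ?_ ha hb hab _ hv.startX_mem _ hv'.startX_mem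
        intro z hz hz' hm
        have hu := R.lt_up p
        rcases hz with rfl | rfl
        · rcases mem_uIcc.1 hm with h | h <;> linarith [h.1]
        · rcases hz' with rfl | rfl
          · exact lt_irrefl _ hv.2
          · exact hvv rfl
      have h1 := main w q h.left hpq hne hrw hrq a ha c hc hac
      have h2 := main q w' hpq h.right hne'.symm hrq hrw' c hc b hb hcb
      exact (h.le q hpq h1).not_gt h2
    · obtain ⟨h1, h2⟩ := aux (R.Y u) hpu le_rfl hur.le (fun h => (hpu' h).elim)
      obtain ⟨c', hc'⟩ := R.nonempty_of_mem hpq.1 ⟨hpu, hur.le.trans hrq⟩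
      exact lt_asymm (h1 _ (R.fst_mem h.left.1) _ hc') (h2 _ hc' _ (R.fst_mem h.right.1))

variable (R)

/-- A charging scheme for edges, written with the lower (or, if horizontal, the left) endpoint
first. Each vertex provides three slots: left, right and up. -/
def Uses (e : V × V) : V ⊕ V ⊕ V → Prop
  | .inl x => (R.Y e.1 = R.Y e.2 ∧ x = e.2) ∨
      ∃ w', R.Next e.1 e.2 w' ∧ R.First e.1 e.2 w' x ∧ x ≠ e.2
  | .inr (.inl x) => x = e.2 ∧ ∃ w', R.Next e.1 e.2 w' ∧ R.First e.1 e.2 w' e.2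
  | .inr (.inr x) => x = e.1 ∧ R.Out e.1 e.2 ∧
      ∀ w', R.Out e.1 w' → R.startX e.1 w' ≤ R.startX e.1 e.2

/-- The edges of the drawing as pairs whose first entry is lower or, in the same row, further
left. -/
def IsEdge (e : V × V) : Prop :=
  G.Adj e.1 e.2 ∧ (R.Y e.1 < R.Y e.2 ∨ R.Y e.1 = R.Y e.2 ∧ R.X e.1 < R.X e.2)

variable {R}

lemma Next.left_lt {u w w' : V} (h : R.Next u w w') {r : ℝ} (hr : R.Y u < r) (hrw : r ≤ R.Y w)
    (hrw' : r ≤ R.Y w') : ∀ a ∈ R.S s(u, w) r, ∀ b ∈ R.S s(u, w') r, a < b := by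
  refine R.transport h.left.1 h.right.1 (h.left.ne h.right (by simp [h.ne])) h.left.up_mem
    ⟨hr.le, hrw⟩ h.right.up_mem ⟨hr.le, hrw'⟩ ?_ h.left.startX_mem h.right.startX_mem h.lt
  intro z hz hz' hm
  have hu := R.lt_up u
  rcases hz with rfl | rfl
  · rcases mem_uIcc.1 hm with h | h <;> linarith [h.1]
  · rcases hz' with rfl | rfl
    · exact lt_irrefl _ h.left.2
    · exact h.ne rfl

lemma IsEdge.exists_uses {e : V × V} (he : R.IsEdge e) : ∃ s, R.Uses e s := by
  classical
  obtain ⟨u, w⟩ := e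
  obtain ⟨hadj, hlt | ⟨heq, -⟩⟩ := he
  swap
  · exact ⟨.inl w, Or.inl ⟨heq, rfl⟩⟩
  have hout : R.Out u w := ⟨hadj, hlt⟩
  by_cases hmax : ∀ w', R.Out u w' → R.startX u w' ≤ R.startX u w
  · exact ⟨.inr (.inr u), rfl, hout, hmax⟩
  push Not at hmax
  obtain ⟨w', hw', hmin⟩ := Finset.exists_min_image
    (Finset.univ.filter fun w' => R.Out u w' ∧ R.startX u w < R.startX u w') (R.startX u)
    (by obtain ⟨w', h⟩ := hmax; exact ⟨w', by simpa using h⟩)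
  simp only [Finset.mem_filter, Finset.mem_univ, true_and] at hw' hmin
  have hnext : R.Next u w w' := ⟨hout, hw'.1, hw'.2, fun w'' h h' => hmin w'' ⟨h, h'⟩⟩
  have hex : ∃ z, R.Gap u w w' z := by
    rcases le_total (R.Y w) (R.Y w') with h | h
    · obtain ⟨b, hb⟩ := R.nonempty_of_mem hw'.1.1 ⟨hlt.le, h⟩
      exact ⟨w, hlt, le_rfl, h, ⟨_, R.snd_mem hadj, le_rfl⟩, b, hb,
        (hnext.left_lt hlt le_rfl h _ (R.snd_mem hadj) _ hb).le⟩
    · obtain ⟨a, ha⟩ := R.nonempty_of_mem hadj ⟨hw'.1.2.le, h⟩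
      exact ⟨w', hw'.1.2, h, le_rfl, ⟨a, ha,
        (hnext.left_lt hw'.1.2 h le_rfl _ ha _ (R.snd_mem hw'.1.1)).le⟩,
        _, R.snd_mem hw'.1.1, le_rfl⟩
  obtain ⟨z, hz, hzmin⟩ := R.exists_lex_min _ hex
  by_cases hzw : z = w
  · subst hzw
    exact ⟨.inr (.inl z), rfl, w', hnext, hz, hzmin⟩
  · exact ⟨.inl z, Or.inr ⟨w', hnext, ⟨hz, hzmin⟩, hzw⟩⟩

omit [Fintype V] in
/-- If the first vertex in the region between `uw` and `uw'` is not `w`, then it lies strictly to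
the right of `uw`, which passes through its row. -/
lemma First.left_lt {u w w' x : V} (h : R.First u w w' x) (hadj : G.Adj u w) (hxw : x ≠ w) :
    R.Y x < R.Y w ∧ x ∉ s(u, w) ∧ ∀ a ∈ R.S s(u, w) (R.Y x), a < R.X x := by
  obtain ⟨a, ha, hax⟩ := h.gap.left
  have hx : x ∉ s(u, w) := by
    rw [Sym2.mem_iff]
    rintro (rfl | rfl)
    · exact lt_irrefl _ h.gap.lt
    · exact hxw rfl
  have hlt := R.lt_X hadj hx ha (lt_of_le_of_ne hax fun h => hx ((R.mem_iff _ hadj x).1 (h ▸ ha)))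
  refine ⟨lt_of_le_of_ne h.gap.le_left fun heq => ?_, hx, hlt⟩
  obtain ⟨b, hb, hxb⟩ := h.gap.right
  have hwx := hlt (R.X w) (heq ▸ R.snd_mem hadj)
  rcases h.min w ⟨heq ▸ h.gap.lt, le_rfl, heq ▸ h.gap.le_right, ⟨_, R.snd_mem hadj, le_rfl⟩,
    b, heq ▸ hb, hwx.le.trans hxb⟩ with h | h
  · linarith
  · linarith [h.2]

/-- Two edges charging the left slot of `x` from the regions to their right are not in order. -/
lemma left_slot_aux {x u w w' p q q' : V} (hn : R.Next u w w') (hf : R.First u w w' x)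
    (hxw : x ≠ w) (hn' : R.Next p q q') (hf' : R.First p q q' x) (hxq : x ≠ q)
    (hne : (u, w) ≠ (p, q)) {a c : ℝ} (ha : a ∈ R.S s(u, w) (R.Y x))
    (hc : c ∈ R.S s(p, q) (R.Y x)) : ¬ a < c := by
  intro hac
  obtain ⟨hxw', hxe, hlt⟩ := hf.left_lt hn.left.1 hxw
  obtain ⟨hxq', hxe', hlt'⟩ := hf'.left_lt hn'.left.1 hxq
  obtain ⟨b, hb, hxb⟩ := hf.gap.right
  have hcx := hlt' c hc
  have hgap := hn.gap_of_between hn'.left hf.gap.lt hf.gap.le_left hf.gap.le_right hf'.gap.lt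
    hxq'.le hne ?_ ha hb hc hac (hcx.trans_le hxb) ?_
  · rcases hf.min p hgap with h | h
    · linarith [hf'.gap.lt]
    · linarith [hf'.gap.lt]
  · rintro ⟨⟩
    exact (hlt' b hb).not_ge hxb
  · intro z hz
    have : R.Y z ≠ R.Y x := by
      rcases Sym2.mem_iff.1 hz with rfl | rfl
      exacts [hf'.gap.lt.ne, hxq'.ne']
    exact ⟨fun _ => this, fun _ => this⟩

lemma left_slot_horizontal {x u w w' p : V} (hn : R.Next u w w') (hf : R.First u w w' x)
    (hxw : x ≠ w) (hadj : G.Adj p x) (hY : R.Y p = R.Y x) (hX : R.X p < R.X x) : False := by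
  obtain ⟨hxw', hxe, hlt⟩ := hf.left_lt hn.left.1 hxw
  obtain ⟨a, ha, -⟩ := hf.gap.left
  obtain ⟨b, hb, hxb⟩ := hf.gap.right
  have hpa : a < R.X p := by
    refine R.transport hn.left.1 hadj ?_ (s := R.Y x) (t := R.Y x) ?_ ?_ ?_ ?_ ?_ ha
      (R.snd_mem hadj) (hlt a ha) a ha (R.X p) (hY ▸ R.fst_mem hadj)
    · intro h
      exact hxe (h ▸ Sym2.mem_mk_right _ _)
    · exact ⟨hf.gap.lt.le, hxw'.le⟩
    · exact ⟨hf.gap.lt.le, hxw'.le⟩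
    · exact ⟨hY.le, le_rfl⟩
    · exact ⟨hY.le, le_rfl⟩
    · intro z hz _ hzx
      simp only [uIcc_self, mem_singleton_iff] at hzx
      rcases hz with rfl | rfl
      · exact hf.gap.lt.ne hzx
      · exact hxw'.ne' hzx
  rcases hf.min p ⟨hY ▸ hf.gap.lt, hY ▸ hf.gap.le_left, hY ▸ hf.gap.le_right,
    ⟨a, hY ▸ ha, hpa.le⟩, b, hY ▸ hb, hX.le.trans hxb⟩ with h | h
  · linarith
  · linarith [h.2]

lemma right_slot_aux {x u w' p q' : V} (hn : R.Next u x w') (hf : R.First u x w' x)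
    (hn' : R.Next p x q') (hne : u ≠ p) {r : ℝ} (hur : R.Y u < r) (hpr : R.Y p < r)
    (hrx : r < R.Y x) {a c : ℝ} (ha : a ∈ R.S s(u, x) r) (hc : c ∈ R.S s(p, x) r) : ¬ a < c := by
  intro hac
  have hfe : (u, w') ≠ (p, x) := by simp [hne]
  obtain ⟨b, hb⟩ := R.nonempty_of_mem hn.right.1 ⟨hur.le, hrx.le.trans hf.gap.le_right⟩
  obtain ⟨b', hb', hxb⟩ := hf.gap.right
  have hxw' : x ∉ s(u, w') := by
    rw [Sym2.mem_iff]
    rintro (rfl | rfl)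
    · exact lt_irrefl _ hf.gap.lt
    · exact hn.ne rfl
  have hcb : c < b := by
    refine R.transport hn'.left.1 hn.right.1 (hn'.left.ne hn.right hfe.symm) (s := R.Y x)
      ⟨hn'.left.2.le, le_rfl⟩ ⟨hpr.le, hrx.le⟩ ⟨hf.gap.lt.le, hf.gap.le_right⟩
      ⟨hur.le, hrx.le.trans hf.gap.le_right⟩ ?_ (R.snd_mem hn'.left.1) hb'
      (lt_of_le_of_ne hxb ?_) c hc b hb
    · intro z hz hz' hm
      rw [uIcc_of_ge hrx.le] at hm
      rcases hz with rfl | rfl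
      · linarith [hm.1]
      · exact hxw' (by simpa using hz')
    · intro h
      exact hxw' ((R.mem_iff _ hn.right.1 x).1 (h ▸ hb'))
  have hgap := hn.gap_of_between hn'.left hur hrx.le (hrx.le.trans hf.gap.le_right) hpr hrx.le
    (by simp [hne]) hfe ha hb hc hac hcb ?_
  · rcases hf.min p hgap with h | h <;> linarith
  · intro z hz
    have : R.Y z ≠ r := by
      rcases Sym2.mem_iff.1 hz with rfl | rfl
      exacts [hpr.ne, hrx.ne']
    exact ⟨fun _ => this, fun _ => this⟩

lemma Uses.unique {e f : V × V} (he : R.IsEdge e) (hf : R.IsEdge f) {s : V ⊕ V ⊕ V}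
    (h : R.Uses e s) (h' : R.Uses f s) : e = f := by
  obtain ⟨u, w⟩ := e
  obtain ⟨p, q⟩ := f
  by_contra hne
  have horiz : ∀ {u w : V}, R.IsEdge (u, w) → R.Y u = R.Y w → R.X u < R.X w :=
    fun h hY => h.2.elim (fun h => (h.ne hY).elim) And.right
  match s, h, h' with
  | .inl x, .inl ⟨h1, h2⟩, .inl ⟨h3, h4⟩ =>
    dsimp only at h1 h2 h3 h4
    subst h2 h4
    have aux : ∀ u p : V, G.Adj u x → R.Y u = R.Y x → R.Y p = R.Y x → R.X p < R.X x →
        R.X u < R.X p → False := by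
      intro u p hu hY hpY hp hup
      have := (R.mem_iff _ hu p).1 (hpY ▸ (R.ordConnected _ hu (R.Y x)).out (hY ▸ R.fst_mem hu)
        (R.snd_mem hu) ⟨hup.le, hp.le⟩)
      rcases Sym2.mem_iff.1 this with rfl | rfl
      · exact lt_irrefl _ hup
      · exact lt_irrefl _ hp
    rcases lt_trichotomy (R.X u) (R.X p) with h | h | h
    · exact aux u p he.1 h1 h3 (horiz hf h3) h
    · exact hne (by rw [R.inj u p h (h1.trans h3.symm)])
    · exact aux p u hf.1 h3 h1 (horiz he h1) h
  | .inl x, .inl ⟨h1, h2⟩, .inr ⟨q', hn, hF, hxq⟩ =>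
    dsimp only at h1 h2
    subst h2
    exact left_slot_horizontal hn hF hxq he.1 h1 (horiz he h1)
  | .inl x, .inr ⟨w', hn, hF, hxw⟩, .inl ⟨h1, h2⟩ =>
    dsimp only at h1 h2
    subst h2
    exact left_slot_horizontal hn hF hxw hf.1 h1 (horiz hf h1)
  | .inl x, .inr ⟨w', hn, hF, hxw⟩, .inr ⟨q', hn', hF', hxq⟩ =>
    obtain ⟨a, ha, -⟩ := hF.gap.left
    obtain ⟨c, hc, -⟩ := hF'.gap.left
    have h1 := left_slot_aux hn hF hxw hn' hF' hxq hne ha hc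
    have h2 := left_slot_aux hn' hF' hxq hn hF hxw (Ne.symm hne) hc ha
    obtain ⟨z, h3, -, -, h4⟩ := R.meet _ hn.left.1 _ hn'.left.1 (hn.left.ne hn'.left hne) _ a ha
      ((le_antisymm (not_lt.1 h2) (not_lt.1 h1)) ▸ hc)
    rcases Sym2.mem_iff.1 h3 with rfl | rfl
    · exact hF.gap.lt.ne' h4
    · exact (hF.left_lt hn.left.1 hxw).1.ne h4
  | .inr (.inl x), ⟨h1, w', hn, hF⟩, ⟨h2, q', hn', hF'⟩ =>
    dsimp only at h1 h2 hn hF hn' hF'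
    subst h1 h2
    have hup : u ≠ p := fun h => hne (by rw [h])
    obtain ⟨r, hr, hrx⟩ := exists_between (max_lt hF.gap.lt hF'.gap.lt)
    obtain ⟨hur, hpr⟩ := max_lt_iff.1 hr
    obtain ⟨a, ha⟩ := R.nonempty_of_mem hn.left.1 ⟨hur.le, hrx.le⟩
    obtain ⟨c, hc⟩ := R.nonempty_of_mem hn'.left.1 ⟨hpr.le, hrx.le⟩
    have h1 := right_slot_aux hn hF hn' hup hur hpr hrx ha hc
    have h2 := right_slot_aux hn' hF' hn hup.symm hpr hur hrx hc ha
    obtain ⟨z, h3, -, -, h4⟩ := R.meet _ hn.left.1 _ hn'.left.1 (hn.left.ne hn'.left hne) _ a ha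
      ((le_antisymm (not_lt.1 h2) (not_lt.1 h1)) ▸ hc)
    rcases Sym2.mem_iff.1 h3 with rfl | rfl
    · exact hur.ne' h4
    · exact hrx.ne h4
  | .inr (.inr x), ⟨h1, ho, hm⟩, ⟨h2, ho', hm'⟩ =>
    dsimp only at h1 h2 ho hm ho' hm'
    subst h1 h2
    exact hne (by rw [ho.startX_inj ho' (le_antisymm (hm' _ ho) (hm _ ho'))])

lemma LeftVis.not_uses {x : V} (h : R.LeftVis x) {e : V × V} (he : R.IsEdge e) :
    ¬ R.Uses e (.inl x) := by
  obtain ⟨u, w⟩ := e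
  rintro (⟨h1, h2⟩ | ⟨w', hn, hf, hxw⟩)
  · dsimp only at h1 h2
    subst h2
    exact (h.1 u h1).not_gt (he.2.elim (fun h => (h.ne h1).elim) And.right)
  · obtain ⟨-, hxe, hlt⟩ := hf.left_lt hn.left.1 hxw
    obtain ⟨a, ha, -⟩ := hf.gap.left
    exact (h.2 _ hn.left.1 hxe a ha).not_gt (hlt a ha)

lemma rightVis_not_uses {x : V} (h : R.flipX.LeftVis x) (e : V × V) :
    ¬ R.Uses e (.inr (.inl x)) := by
  obtain ⟨u, w⟩ := e
  rintro ⟨rfl, w', hn, hf⟩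
  dsimp only at hn hf
  obtain ⟨b, hb, hxb⟩ := hf.gap.right
  have hx : x ∉ s(u, w') := by
    rw [Sym2.mem_iff]
    rintro (rfl | rfl)
    · exact lt_irrefl _ hf.gap.lt
    · exact hn.ne rfl
  have h1 := h.2 _ hn.right.1 hx (-b) (by simpa [flipX] using hb)
  have h2 : b ≤ R.X x := neg_le_neg_iff.1 h1
  exact hx ((R.mem_iff _ hn.right.1 x).1 (le_antisymm hxb h2 ▸ hb))

lemma not_uses_right {x : V} (h : ∀ u, ¬ R.Out u x) (e : V × V) :
    ¬ R.Uses e (.inr (.inl x)) := by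
  rintro ⟨rfl, w', hn, -⟩
  exact h _ hn.left

lemma not_uses_up {x : V} (h : ∀ u, ¬ R.Out x u) (e : V × V) :
    ¬ R.Uses e (.inr (.inr x)) := by
  rintro ⟨rfl, ho, -⟩
  exact h _ ho

variable (R)

/-- The number of edges is at most the number of slots that are not known to be free. -/
lemma card_edges_add_le (A B C : Finset V)
    (hA : ∀ x ∈ A, ∀ e, R.IsEdge e → ¬ R.Uses e (.inl x))
    (hB : ∀ x ∈ B, ∀ e, R.IsEdge e → ¬ R.Uses e (.inr (.inl x)))
    (hC : ∀ x ∈ C, ∀ e, R.IsEdge e → ¬ R.Uses e (.inr (.inr x))) :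
    G.edgeSet.ncard + (A.card + B.card + C.card) ≤ 3 * Fintype.card V := by
  classical
  set P : Finset (V × V) := Finset.univ.filter R.IsEdge
  have h1 : G.edgeSet.ncard ≤ P.card := by
    rw [← Set.ncard_coe_finset P]
    refine (Set.ncard_le_ncard ?_ (Set.toFinite _)).trans
      (Set.ncard_image_le (f := fun e : V × V => s(e.1, e.2)) P.finite_toSet)
    intro e he
    induction e with | _ p q
    have hpq : G.Adj p q := he
    have key : ∀ {p q : V}, G.Adj p q → R.Y p ≤ R.Y q → (R.Y p = R.Y q → R.X p < R.X q) →
        (p, q) ∈ P := by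
      intro p q h hY hX
      simp only [P, Finset.mem_filter, Finset.mem_univ, true_and]
      exact ⟨h, hY.lt_or_eq.imp_right fun h => ⟨h, hX h⟩⟩
    rcases lt_trichotomy (R.Y p) (R.Y q) with h | h | h
    · exact ⟨(p, q), key hpq h.le (fun h' => (h.ne h').elim), rfl⟩
    · rcases lt_trichotomy (R.X p) (R.X q) with h' | h' | h'
      · exact ⟨(p, q), key hpq h.le fun _ => h', rfl⟩
      · exact (hpq.ne (R.inj _ _ h' h)).elim
      · exact ⟨(q, p), key hpq.symm h.ge fun _ => h', Sym2.eq_swap⟩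
    · exact ⟨(q, p), key hpq.symm h.le (fun h' => (h.ne h').elim), Sym2.eq_swap⟩
  set D : Finset (V ⊕ V ⊕ V) := A.disjSum (B.disjSum C)
  have h2 : P.card ≤ Dᶜ.card := by
    refine Finset.card_le_card_of_forall_subsingleton R.Uses (fun e he => ?_) fun s _ e he f hf => ?_
    · have he : R.IsEdge e := by simpa [P] using he
      obtain ⟨s, hs⟩ := he.exists_uses
      refine ⟨s, ?_, hs⟩
      rw [Finset.mem_compl]
      intro hsD
      rcases s with x | x | x
      · exact hA x (by simpa [D] using hsD) e he hs
      · exact hB x (by simpa [D] using hsD) e he hs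
      · exact hC x (by simpa [D] using hsD) e he hs
    · exact Uses.unique (by simpa [P] using he.1) (by simpa [P] using hf.1) he.2 hf.2
  have h3 : D.card = A.card + (B.card + C.card) := by simp [D]
  have h4 := Finset.card_add_card_compl D
  simp only [Fintype.card_sum] at h4
  omega

/-- Existence of a left-visible vertex in a row crossed by no edge. -/
lemma exists_leftVis {m : ℝ} (hm : ∃ z, R.Y z = m)
    (hthrough : ∀ p q, G.Adj p q → R.Y p < m → m < R.Y q → False) :
    ∃ x, R.Y x = m ∧ R.LeftVis x ∧ ∀ z, R.Y z = m → R.X x ≤ R.X z := by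
  obtain ⟨x, hx, hmin⟩ := R.exists_lex_min _ hm
  have hle : ∀ z, R.Y z = m → R.X x ≤ R.X z := fun z hz =>
    (hmin z hz).elim (fun h => (h.ne (hx.trans hz.symm)).elim) And.right
  refine ⟨x, hx, ?_, hle⟩
  by_contra hnv
  obtain ⟨p, q, hpq, h1, h2, -⟩ := R.exists_through (fun z hz => hle z (hz.trans hx)) hnv
  exact hthrough p q hpq (hx ▸ h1) (hx ▸ h2)

/-- A drawing with a vertex that has no neighbour weakly below it and is visible neither from the
left, nor from the right, nor from below, has fewer edges than a triangulation. -/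
theorem card_edges_lt {v : V} (hup : ∀ w, G.Adj v w → R.Y v < R.Y w) (hl : ¬ R.LeftVis v)
    (hr : ¬ R.flipX.LeftVis v) (hlow : ∃ z, R.Y z < R.Y v) :
    G.edgeSet.ncard + 7 ≤ 3 * Fintype.card V := by
  classical
  obtain ⟨z₀, -, hz₀⟩ := Finset.exists_min_image Finset.univ R.Y ⟨v, Finset.mem_univ v⟩
  obtain ⟨z₁, -, hz₁⟩ := Finset.exists_max_image Finset.univ R.Y ⟨v, Finset.mem_univ v⟩
  simp only [Finset.mem_univ, forall_const] at hz₀ hz₁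
  obtain ⟨m, hm⟩ : ∃ m, m = R.Y z₀ := ⟨_, rfl⟩
  obtain ⟨M, hM⟩ : ∃ M, M = R.Y z₁ := ⟨_, rfl⟩
  rw [← hm] at hz₀
  rw [← hM] at hz₁
  have hmv : m < R.Y v := by
    obtain ⟨z, hz⟩ := hlow
    exact (hz₀ z).trans_lt hz
  have hmM : m < M := hmv.trans_le (hz₁ v)
  have hmt : ∀ p q, G.Adj p q → R.Y p < m → m < R.Y q → False :=
    fun p _ _ h _ => (hz₀ p).not_gt h
  have hMt : ∀ p q, G.Adj p q → R.Y p < M → M < R.Y q → False :=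
    fun _ q _ _ h => (hz₁ q).not_gt h
  obtain ⟨bl, hbl, hblv, hblx⟩ := R.exists_leftVis ⟨z₀, hm.symm⟩ hmt
  obtain ⟨tl, htl, htlv, htlx⟩ := R.exists_leftVis ⟨z₁, hM.symm⟩ hMt
  obtain ⟨br, hbr, hbrv, hbrx⟩ := R.flipX.exists_leftVis ⟨z₀, hm.symm⟩ hmt
  obtain ⟨tr, htr, htrv, htrx⟩ := R.flipX.exists_leftVis ⟨z₁, hM.symm⟩ hMt
  replace hbr : R.Y br = m := hbr
  replace htr : R.Y tr = M := htr
  have hvin : ∀ u, ¬ R.Out u v := fun u hu => lt_asymm hu.2 (hup u hu.1.symm)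
  have hA : ∀ x, R.LeftVis x → ∀ e, R.IsEdge e → ¬ R.Uses e (.inl x) :=
    fun x hx e he => hx.not_uses he
  have hB : ∀ x, (R.flipX.LeftVis x ∨ ∀ u, ¬ R.Out u x) →
      ∀ e, R.IsEdge e → ¬ R.Uses e (.inr (.inl x)) :=
    fun x hx e _ => hx.elim (fun h => rightVis_not_uses h e) fun h => not_uses_right h e
  have hC : ∀ x, (∀ u, ¬ R.Out x u) → ∀ e, R.IsEdge e → ¬ R.Uses e (.inr (.inr x)) :=
    fun x hx e _ => not_uses_up hx e
  have htop : ∀ x, R.Y x = M → ∀ u, ¬ R.Out x u := fun x hx u hu =>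
    (hz₁ u).not_gt (hx ▸ hu.2)
  have hbot : ∀ x, R.Y x = m → ∀ u, ¬ R.Out u x := fun x hx u hu =>
    (hz₀ u).not_gt (hx ▸ hu.2)
  have hbtl : bl ≠ tl := fun h => hmM.ne (by rw [← hbl, ← htl, h])
  have hbtr : br ≠ tr := fun h => hmM.ne (by rw [← hbr, ← htr, h])
  have hbv : br ≠ v := fun h => hr (h ▸ hbrv)
  have htv : tr ≠ v := fun h => hr (h ▸ htrv)
  have hA' : ∀ x ∈ ({bl, tl} : Finset V), R.LeftVis x := by
    simpa using ⟨hblv, htlv⟩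
  have hB' : ∀ x ∈ ({br, tr, v} : Finset V), R.flipX.LeftVis x ∨ ∀ u, ¬ R.Out u x := by
    simpa using ⟨.inl hbrv, .inl htrv, .inr hvin⟩
  have hC' : ∀ x ∈ ({tl} : Finset V), ∀ u, ¬ R.Out x u := by
    simpa using htop tl htl
  have cA : ({bl, tl} : Finset V).card = 2 := Finset.card_pair hbtl
  have cB : ({br, tr, v} : Finset V).card = 3 := by
    rw [Finset.card_eq_three]
    exact ⟨br, tr, v, hbtr, hbv, htv, rfl⟩
  have useA : ∀ x, R.LeftVis x → x ∉ ({bl, tl} : Finset V) →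
      G.edgeSet.ncard + 7 ≤ 3 * Fintype.card V := by
    intro x hx hx'
    have := R.card_edges_add_le (insert x {bl, tl}) {br, tr, v} {tl}
      (fun y hy => hA y ((Finset.mem_insert.1 hy).elim (fun h => h ▸ hx) (hA' y)))
      (fun y hy => hB y (hB' y hy)) (fun y hy => hC y (hC' y hy))
    rwa [Finset.card_insert_of_notMem hx', cA, cB, Finset.card_singleton] at this
  have useB : ∀ x, (R.flipX.LeftVis x ∨ ∀ u, ¬ R.Out u x) → x ∉ ({br, tr, v} : Finset V) →
      G.edgeSet.ncard + 7 ≤ 3 * Fintype.card V := by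
    intro x hx hx'
    have := R.card_edges_add_le {bl, tl} (insert x {br, tr, v}) {tl}
      (fun y hy => hA y (hA' y hy))
      (fun y hy => hB y ((Finset.mem_insert.1 hy).elim (fun h => h ▸ hx) (hB' y)))
      (fun y hy => hC y (hC' y hy))
    rwa [Finset.card_insert_of_notMem hx', cA, cB, Finset.card_singleton] at this
  have useC : ∀ x, (∀ u, ¬ R.Out x u) → x ∉ ({tl} : Finset V) →
      G.edgeSet.ncard + 7 ≤ 3 * Fintype.card V := by
    intro x hx hx'
    have := R.card_edges_add_le {bl, tl} {br, tr, v} (insert x {tl})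
      (fun y hy => hA y (hA' y hy)) (fun y hy => hB y (hB' y hy))
      (fun y hy => hC y ((Finset.mem_insert.1 hy).elim (fun h => h ▸ hx) (hC' y)))
    rwa [Finset.card_insert_of_notMem hx', cA, cB, Finset.card_singleton] at this
  rcases (hz₁ v).eq_or_lt with hvM | hvM
  · exact useC v (htop v hvM) (by simpa using fun h : v = tl => hl (h ▸ htlv))
  by_cases htt : tr = tl
  swap
  · exact useC tr (htop tr htr) (by simpa using htt)
  by_cases hbb : bl = br
  swap
  · refine useB bl (.inr (hbot bl hbl)) ?_
    simp only [Finset.mem_insert, Finset.mem_singleton, not_or]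
    refine ⟨hbb, fun h => hmM.ne ?_, fun h => hmv.ne ?_⟩
    · rw [← hbl, ← htr, h]
    · rw [← hbl, h]
  by_cases hvl : ∃ z, m < R.Y z ∧ R.Y z < M ∧ R.LeftVis z
  · obtain ⟨z, h1, h2, h3⟩ := hvl
    refine useA z h3 ?_
    simp only [Finset.mem_insert, Finset.mem_singleton, not_or]
    exact ⟨fun h => h1.ne (by rw [h, hbl]), fun h => h2.ne (by rw [h, htl])⟩
  by_cases hvr : ∃ z, m < R.Y z ∧ R.Y z < M ∧ R.flipX.LeftVis z
  · obtain ⟨z, h1, h2, h3⟩ := hvr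
    refine useB z (.inl h3) ?_
    simp only [Finset.mem_insert, Finset.mem_singleton, not_or]
    exact ⟨fun h => h1.ne (by rw [h, hbr]), fun h => h2.ne (by rw [h, htr]), fun h => hr (h ▸ h3)⟩
  exfalso
  push Not at hvl hvr
  subst hbb htt
  obtain ⟨p, q, hpq, hp, hq, a, ha, hav⟩ := R.exists_left_edge hz₀ hz₁ hvl hmv hvM
  obtain ⟨p', q', hpq', hp', hq', b, hb, hbv⟩ := R.flipX.exists_left_edge hz₀ hz₁ hvr hmv hvM
  have huniq : ∀ (bt : V) (s : ℝ), (∀ z, R.Y z = s → R.X bt ≤ R.X z) →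
      (∀ z, R.Y z = s → R.flipX.X bt ≤ R.flipX.X z) → R.Y bt = s → ∀ z, R.Y z = s → z = bt :=
    fun bt s h1 h2 h3 z hz => R.inj _ _ (le_antisymm (neg_le_neg_iff.1 (h2 z hz)) (h1 z hz))
      (hz.trans h3.symm)
  have hbu := huniq bl m hblx hbrx hbl
  have htu := huniq tr M htlx htrx htl
  rw [hbu p hp, htu q hq] at ha hpq
  rw [hbu p' hp', htu q' hq'] at hb
  have hmem := (R.ordConnected _ hpq _).out ha hb ⟨hav.le, by
    have h : b < -R.X v := hbv
    linarith⟩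
  rcases Sym2.mem_iff.1 ((R.mem_iff _ hpq v).1 hmem) with rfl | rfl
  · exact hmv.ne' hbl
  · exact htv rfl

end RowDrawing

section Chains

/-- Reflection in the `x`-axis. -/
def reflectPt (p : Pt) : Pt := (p.1, -p.2)

lemma reflectPt_mem_chainSet : ∀ (l : List Pt) {p : Pt}, p ∈ chainSet l →
    reflectPt p ∈ chainSet (l.map reflectPt)
  | [], _, h => h.elim
  | [a], p, h => by
    have : p = a := h
    subst this
    exact mem_singleton _
  | a :: b :: l, p, h => by
    rcases h with h | h
    · left
      obtain ⟨s, t, hs, ht, hst, rfl⟩ := h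
      refine ⟨s, t, hs, ht, hst, ?_⟩
      ext <;> simp [reflectPt]
      ring
    · exact Or.inr (reflectPt_mem_chainSet (b :: l) h)

lemma reflectPt_reflectPt (p : Pt) : reflectPt (reflectPt p) = p := by
  simp [reflectPt]

lemma reflectPt_mem_chainSet_iff (l : List Pt) {p : Pt} :
    reflectPt p ∈ chainSet (l.map reflectPt) ↔ p ∈ chainSet l := by
  refine ⟨fun h => ?_, reflectPt_mem_chainSet l⟩
  have := reflectPt_mem_chainSet _ h
  have hid : reflectPt ∘ reflectPt = id := funext reflectPt_reflectPt
  rwa [List.map_map, hid, List.map_id, reflectPt_reflectPt] at this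

lemma isChain_reflectPt {l : List Pt} (h : List.IsChain (· ≥ ·) (l.map Prod.snd)) :
    List.IsChain (· ≤ ·) ((l.map reflectPt).map Prod.snd) := by
  rw [List.map_map, List.isChain_map]
  rw [List.isChain_map] at h
  exact h.imp fun a b hab => neg_le_neg hab

lemma snd_mem_Icc_of_isChain : ∀ (l : List Pt), List.IsChain (· ≤ ·) (l.map Prod.snd) →
    ∀ {a b p : Pt}, l.head? = some a → l.getLast? = some b → p ∈ chainSet l →
      p.2 ∈ Icc a.2 b.2
  | [], _, _, _, _, _, _, h => h.elim
  | [c], _, a, b, p, ha, hb, h => by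
    have : p = c := h
    simp_all
  | c :: d :: l, hl, a, b, p, ha, hb, h => by
    simp only [List.map_cons, List.isChain_cons_cons] at hl
    have ih := fun {q : Pt} => snd_mem_Icc_of_isChain (d :: l) hl.2 (a := d) (b := b) (p := q) rfl
      (by simpa using hb)
    have hc : c = a := by simpa using ha
    subst hc
    have hd : d ∈ chainSet (d :: l) := by
      cases l with
      | nil => exact mem_singleton _
      | cons e l => exact Or.inl (left_mem_segment ℝ _ _)
    rcases h with h | h
    · have h1 := (Prod.segment_subset c d h).2
      rw [segment_eq_Icc hl.1] at h1
      exact ⟨h1.1, h1.2.trans (ih hd).2⟩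
    · exact ⟨hl.1.trans (ih h).1, (ih h).2⟩

lemma ordConnected_row_of_convex {C : Set Pt} (hC : Convex ℝ C) (t : ℝ) :
    (rowSlice C t).OrdConnected := by
  refine Convex.ordConnected fun x hx y hy a b ha hb hab => ?_
  have := hC hx hy ha hb hab
  have h2 : a • ((x, t) : Pt) + b • ((y, t) : Pt) = (a • x + b • y, t) := by
    ext
    · simp
    · simp [← add_mul, hab]
  rwa [h2] at this

lemma ordConnected_union {s t : Set ℝ} (hs : s.OrdConnected) (ht : t.OrdConnected) {c : ℝ}
    (hcs : c ∈ s) (hct : c ∈ t) : (s ∪ t).OrdConnected :=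
  (hs.isPreconnected.union c hcs hct ht.isPreconnected).ordConnected

lemma ordConnected_row_of_isChain : ∀ (l : List Pt), List.IsChain (· ≤ ·) (l.map Prod.snd) →
    ∀ t, (rowSlice (chainSet l) t).OrdConnected
  | [], _, t => ordConnected_row_of_convex convex_empty t
  | [c], _, t => ordConnected_row_of_convex (convex_singleton c) t
  | c :: d :: l, hl, t => by
    simp only [List.map_cons, List.isChain_cons_cons] at hl
    have ih := ordConnected_row_of_isChain (d :: l) hl.2 t
    have hseg := ordConnected_row_of_convex (convex_segment (𝕜 := ℝ) c d) t
    have hd : d ∈ chainSet (d :: l) := by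
      cases l with
      | nil => exact mem_singleton _
      | cons e l => exact Or.inl (left_mem_segment ℝ _ _)
    have hun : rowSlice (chainSet (c :: d :: l)) t =
        rowSlice (segment ℝ c d) t ∪ rowSlice (chainSet (d :: l)) t := rfl
    rw [hun]
    rcases (rowSlice (segment ℝ c d) t).eq_empty_or_nonempty with h | ⟨x, hx⟩
    · rwa [h, empty_union]
    rcases (rowSlice (chainSet (d :: l)) t).eq_empty_or_nonempty with h | ⟨y, hy⟩
    · rwa [h, union_empty]
    have h1 : t ≤ d.2 := by
      have := (Prod.segment_subset c d hx).2
      rw [segment_eq_Icc hl.1] at this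
      exact this.2
    have h2 : d.2 ≤ t := (snd_mem_Icc_of_isChain (d :: l) hl.2 rfl
      (List.getLast?_eq_some_getLast (List.cons_ne_nil d l)) hy).1
    have h3 : t = d.2 := le_antisymm h1 h2
    subst h3
    exact ordConnected_union hseg ih (c := d.1) (right_mem_segment ℝ c d) hd

lemma snd_mem_uIcc_of_monotone {l : List Pt} (h : List.IsChain (· ≤ ·) (l.map Prod.snd) ∨
    List.IsChain (· ≥ ·) (l.map Prod.snd)) {a b p : Pt} (ha : l.head? = some a)
    (hb : l.getLast? = some b) (hp : p ∈ chainSet l) : p.2 ∈ uIcc a.2 b.2 := by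
  rcases h with h | h
  · exact Icc_subset_uIcc (snd_mem_Icc_of_isChain l h ha hb hp)
  · have := snd_mem_Icc_of_isChain _ (isChain_reflectPt h) (a := reflectPt a) (b := reflectPt b)
      (by simp [ha]) (by simp [hb]) (reflectPt_mem_chainSet l hp)
    exact Icc_subset_uIcc' ⟨neg_le_neg_iff.1 this.2, neg_le_neg_iff.1 this.1⟩

lemma ordConnected_row_of_monotone {l : List Pt} (h : List.IsChain (· ≤ ·) (l.map Prod.snd) ∨
    List.IsChain (· ≥ ·) (l.map Prod.snd)) (t : ℝ) : (rowSlice (chainSet l) t).OrdConnected := by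
  rcases h with h | h
  · exact ordConnected_row_of_isChain l h t
  · have := ordConnected_row_of_isChain _ (isChain_reflectPt h) (-t)
    have heq : rowSlice (chainSet l) t = rowSlice (chainSet (l.map reflectPt)) (-t) := by
      ext x
      exact (reflectPt_mem_chainSet_iff l (p := (x, t))).symm
    rwa [heq]

end Chains

/-- Compact sets with disjoint interval rows keep their left-to-right order. -/
lemma rowSlice_order {K L : Set Pt} (hK : IsCompact K) (hL : IsCompact L)
    (hKo : ∀ t, (rowSlice K t).OrdConnected) (hLo : ∀ t, (rowSlice L t).OrdConnected) {s t : ℝ}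
    (h : ∀ r ∈ uIcc s t, (rowSlice K r).Nonempty ∧ (rowSlice L r).Nonempty ∧
      Disjoint (rowSlice K r) (rowSlice L r))
    {a b : ℝ} (ha : a ∈ rowSlice K s) (hb : b ∈ rowSlice L s) (hab : a < b) :
    ∀ a' ∈ rowSlice K t, ∀ b' ∈ rowSlice L t, a' < b' := by
  intro a' ha' b' hb'
  by_contra! hlt
  have closed : ∀ F : Set (Pt × Pt), IsClosed F →
      IsClosed ((fun p : Pt × Pt => p.1.2) '' ((K ×ˢ L) ∩ ({p | p.1.2 = p.2.2} ∩ F))) := by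
    intro F hF
    refine (((hK.prod hL).inter_right (IsClosed.inter ?_ hF)).image (by fun_prop)).isClosed
    exact isClosed_eq (by fun_prop) (by fun_prop)
  have h1 := closed {p | p.1.1 ≤ p.2.1} (isClosed_le (by fun_prop) (by fun_prop))
  have h2 := closed {p | p.2.1 ≤ p.1.1} (isClosed_le (by fun_prop) (by fun_prop))
  obtain ⟨r, hr, ⟨⟨⟨x, y⟩, ⟨x', y'⟩⟩, ⟨⟨hx, hx'⟩, hy, hle⟩, hyr⟩,
      ⟨⟨⟨z, w⟩, ⟨z', w'⟩⟩, ⟨⟨hz, hz'⟩, hw, hle'⟩, hwr⟩⟩ :=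
    isPreconnected_closed_iff.1 (isPreconnected_uIcc (a := s) (b := t)) _ _ h1 h2
      (by
        intro r hr
        obtain ⟨⟨x, hx⟩, ⟨y, hy⟩, -⟩ := h r hr
        rcases le_total x y with hxy | hxy
        · exact Or.inl ⟨((x, r), (y, r)), ⟨⟨hx, hy⟩, rfl, hxy⟩, rfl⟩
        · exact Or.inr ⟨((x, r), (y, r)), ⟨⟨hx, hy⟩, rfl, hxy⟩, rfl⟩)
      ⟨s, left_mem_uIcc, ((a, s), (b, s)), ⟨⟨ha, hb⟩, rfl, hab.le⟩, rfl⟩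
      ⟨t, right_mem_uIcc, ((a', t), (b', t)), ⟨⟨ha', hb'⟩, rfl, hlt⟩, rfl⟩
  change y = y' at hy
  change w = w' at hw
  change y = r at hyr
  change w = r at hwr
  subst hy hyr hw hwr
  have hd := disjoint_left.1 (h _ hr).2.2
  have hxz := (hKo _).out hx hz
  have hzx' := (hLo _).out hz' hx'
  rcases le_total x' z with h3 | h3
  · exact hd (hxz ⟨hle, h3⟩) hx'
  · exact hd hz (hzx' ⟨hle', h3⟩)

namespace PolyDrawing

variable {V : Type} {G : SimpleGraph V} (Γ : PolyDrawing G)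

lemma isCompact_edgePts {e : Sym2 V} (he : e ∈ G.edgeSet) : IsCompact (Γ.edgePts e) := by
  induction e with | _ u w
  obtain ⟨γ, hγ, -, him, -, -⟩ := Γ.arc_simple u w he
  rw [edgePts, ← him]
  exact isCompact_Icc.image_of_continuousOn hγ

lemma pos_mem_edgePts {e : Sym2 V} (he : e ∈ G.edgeSet) {z : V} (hz : z ∈ e) :
    Γ.pos z ∈ Γ.edgePts e := by
  induction e with | _ u w
  obtain ⟨γ, -, -, him, h0, h1⟩ := Γ.arc_simple u w he
  rw [edgePts, ← him]
  rcases Sym2.mem_iff.1 hz with rfl | rfl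
  · exact ⟨0, by simp, h0⟩
  · exact ⟨1, by simp, h1⟩

variable {Γ}

lemma IsYMonotone.snd_mem_uIcc (hmono : Γ.IsYMonotone) {u w : V} (h : G.Adj u w) {p : Pt}
    (hp : p ∈ Γ.edgePts s(u, w)) : p.2 ∈ uIcc (Γ.pos u).2 (Γ.pos w).2 := by
  rcases Γ.arc_ends u w h with ⟨h1, h2⟩ | ⟨h1, h2⟩
  · exact snd_mem_uIcc_of_monotone (hmono _ h) h1 h2 hp
  · rw [uIcc_comm]
    exact snd_mem_uIcc_of_monotone (hmono _ h) h1 h2 hp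

/-- The row-by-row data of a planar `y`-monotone poly-line drawing. -/
def toRowDrawing (Γ : PolyDrawing G) (hpl : Γ.IsPlanar) (hmono : Γ.IsYMonotone) :
    RowDrawing G where
  X v := (Γ.pos v).1
  Y v := (Γ.pos v).2
  S e t := rowSlice (Γ.edgePts e) t
  inj u v h h' := Γ.pos_inj (Prod.ext h h')
  ordConnected e he t := ordConnected_row_of_monotone (hmono e he) t
  nonempty u w h t ht := by
    obtain ⟨γ, hγ, -, him, h0, h1⟩ := Γ.arc_simple u w h
    have hy : ContinuousOn (fun s => (γ s).2) (uIcc 0 1) := by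
      rw [uIcc_of_le zero_le_one]
      exact continuous_snd.comp_continuousOn hγ
    obtain ⟨s, hs, rfl⟩ := intermediate_value_uIcc hy (by simpa only [h0, h1] using ht)
    rw [uIcc_of_le zero_le_one] at hs
    exact ⟨(γ s).1, him.subset (mem_image_of_mem γ hs)⟩
  range u w h t ht := by
    obtain ⟨x, hx⟩ := ht
    exact hmono.snd_mem_uIcc h hx
  mem_iff e he z := by
    refine ⟨fun h => ?_, fun h => Γ.pos_mem_edgePts he h⟩
    by_contra hz
    exact hpl.1 z e he hz h
  meet e he f hf hne t x hx hx' := by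
    obtain ⟨z, h1, h2, h3⟩ := hpl.2 e he f hf hne (x, t) ⟨hx, hx'⟩
    exact ⟨z, h1, h2, congrArg Prod.fst h3, congrArg Prod.snd h3⟩
  order e he f hf s t h a ha b hb hab :=
    rowSlice_order (Γ.isCompact_edgePts he) (Γ.isCompact_edgePts hf)
      (fun t => ordConnected_row_of_monotone (hmono e he) t)
      (fun t => ordConnected_row_of_monotone (hmono f hf) t) h ha hb hab

variable (Γ) in
/-- A vertex that can be approached from an unbounded convex set avoiding the drawing is not
inner. -/
lemma not_isInner_of_convex {C : Set Pt} (hC : Convex ℝ C) (hb : ¬ Bornology.IsBounded C)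
    (hd : Disjoint C Γ.image) {v : V} (hv : Γ.pos v ∈ closure C) : ¬ Γ.IsInner v := by
  have hsub : C ⊆ Γ.outerRegion := by
    intro p hp
    refine ⟨disjoint_left.1 hd hp, fun hbdd => hb (hbdd.subset ?_)⟩
    exact hC.isPreconnected.subset_connectedComponentIn hp hd.subset_compl_right
  rw [IsInner, not_not]
  refine ⟨closure_mono hsub hv, fun hint => ?_⟩
  exact (interior_subset hint).1 (Or.inl ⟨v, rfl⟩)

lemma mem_image {p : Pt} (hp : p ∈ Γ.image) :
    (∃ z, p = Γ.pos z) ∨ ∃ e ∈ G.edgeSet, p ∈ Γ.edgePts e := by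
  rcases hp with ⟨z, rfl⟩ | hp
  · exact Or.inl ⟨z, rfl⟩
  · simp only [mem_iUnion, exists_prop] at hp
    exact Or.inr hp

/-- A vertex in the lowest (`τ = 1`) or highest (`τ = -1`) row is not inner. -/
lemma not_isInner_of_extreme (hmono : Γ.IsYMonotone) {v : V} {τ : ℝ} (hτ : τ = 1 ∨ τ = -1)
    (h : ∀ z, τ * (Γ.pos v).2 ≤ τ * (Γ.pos z).2) : ¬ Γ.IsInner v := by
  refine Γ.not_isInner_of_convex (C := {p : Pt | τ * p.2 < τ * (Γ.pos v).2}) ?_ ?_ ?_ ?_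
  · exact convex_halfSpace_lt (f := fun p : Pt => τ * p.2)
      ⟨fun x y => by simp [mul_add], fun c x => by simp; ring⟩ _
  · intro hb
    obtain ⟨r, hr⟩ := hb.subset_closedBall (Γ.pos v)
    have hmem := hr (show ((Γ.pos v).1, (Γ.pos v).2 - τ * (|r| + 1)) ∈ {p : Pt | τ * p.2 < τ * (Γ.pos v).2} by
      have := abs_nonneg r
      change τ * ((Γ.pos v).2 - τ * (|r| + 1)) < τ * (Γ.pos v).2
      rcases hτ with rfl | rfl <;> linarith)
    have h2 : |(Γ.pos v).2 - τ * (|r| + 1) - (Γ.pos v).2| ≤ r :=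
      (le_max_right _ _).trans (Metric.mem_closedBall.1 hmem)
    have habs : |τ| = 1 := by rcases hτ with rfl | rfl <;> simp
    rw [sub_sub_cancel_left, abs_neg, abs_mul, habs, one_mul, abs_of_pos (by positivity)] at h2
    linarith [le_abs_self r]
  · rw [disjoint_left]
    intro p hp himg
    rcases mem_image himg with ⟨z, rfl⟩ | ⟨e, he, hpe⟩
    · exact (h z).not_gt hp
    · induction e with | _ u w
      have hu := h u
      have hw := h w
      have hp : τ * p.2 < τ * (Γ.pos v).2 := hp
      rcases hτ with rfl | rfl <;> rcases mem_uIcc.1 (hmono.snd_mem_uIcc he hpe) with h | h <;>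
        linarith [h.1, h.2]
  · rw [Metric.mem_closure_iff]
    intro ε hε
    refine ⟨((Γ.pos v).1, (Γ.pos v).2 - τ * (ε / 2)), ?_, ?_⟩
    · rcases hτ with rfl | rfl <;> simp <;> positivity
    · rw [Prod.dist_eq]
      rcases hτ with rfl | rfl <;> simp [abs_of_pos hε, hε]

/-- A vertex `v` without a neighbour weakly below it (`τ = 1`) or weakly above it (`τ = -1`) such
that the row of `v` is free to the left (`σ = 1`) or to the right (`σ = -1`) is not inner. -/
lemma not_isInner_of_visible [Finite V] (hpl : Γ.IsPlanar) (hmono : Γ.IsYMonotone) {v : V}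
    {σ τ : ℝ} (hσ : σ = 1 ∨ σ = -1) (hτ : τ = 1 ∨ τ = -1)
    (hup : ∀ w, G.Adj v w → τ * (Γ.pos v).2 < τ * (Γ.pos w).2)
    (hvert : ∀ z, (Γ.pos z).2 = (Γ.pos v).2 → σ * (Γ.pos v).1 ≤ σ * (Γ.pos z).1)
    (hedge : ∀ e ∈ G.edgeSet, v ∉ e → ∀ b, (b, (Γ.pos v).2) ∈ Γ.edgePts e →
      σ * (Γ.pos v).1 ≤ σ * b) : ¬ Γ.IsInner v := by
  have hσ0 : σ ≠ 0 := by rcases hσ with rfl | rfl <;> norm_num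
  set K : Set Pt := (⋃ e ∈ {e | e ∈ G.edgeSet ∧ v ∉ e}, Γ.edgePts e) ∪ Γ.pos '' {z | z ≠ v}
  set H : Set Pt := {p | p.2 = (Γ.pos v).2 ∧ σ * p.1 ≤ σ * (Γ.pos v).1}
  have hK : IsCompact K :=
    ((Set.toFinite _).isCompact_biUnion fun e he => Γ.isCompact_edgePts he.1).union
      (Set.toFinite _).isCompact
  have hH : IsClosed H := (isClosed_eq continuous_snd continuous_const).inter
    (isClosed_le (continuous_const.mul continuous_fst) continuous_const)
  have hKH : Disjoint K H := by
    rw [disjoint_left]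
    rintro ⟨x, y⟩ hp ⟨rfl, hx⟩
    rcases hp with hp | ⟨z, hz, hzp⟩
    · simp only [mem_iUnion, exists_prop] at hp
      obtain ⟨e, ⟨he, hve⟩, hp⟩ := hp
      have hxv := mul_left_cancel₀ hσ0 (le_antisymm hx (hedge e he hve _ hp))
      dsimp only at hxv
      subst hxv
      exact hpl.1 v e he hve hp
    · obtain ⟨rfl, hz2⟩ := Prod.ext_iff.1 hzp
      exact hz (Γ.pos_inj (Prod.ext (mul_left_cancel₀ hσ0 (le_antisymm hx (hvert z hz2))) hz2))
  obtain ⟨δ, hδ, hdis⟩ := hKH.exists_thickenings hK hH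
  have hCK : ∀ p : Pt, σ * p.1 ≤ σ * (Γ.pos v).1 → p.2 ∈ Metric.ball (Γ.pos v).2 δ → p ∉ K := by
    intro p hp hp2 hpK
    refine disjoint_left.1 hdis (Metric.self_subset_thickening hδ K hpK) ?_
    rw [Metric.mem_thickening_iff]
    refine ⟨(p.1, (Γ.pos v).2), ⟨rfl, hp⟩, ?_⟩
    rw [Prod.dist_eq]
    simpa [hδ] using hp2
  have hCmem : ∀ a η : ℝ, 0 ≤ a → 0 < η → η < δ →
      ((Γ.pos v).1 - σ * a, (Γ.pos v).2 - τ * η) ∈ {p : Pt | σ * p.1 ≤ σ * (Γ.pos v).1} ∩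
        ({p : Pt | τ * p.2 < τ * (Γ.pos v).2} ∩ {p | p.2 ∈ Metric.ball (Γ.pos v).2 δ}) := by
    intro a η ha hη hηδ
    refine ⟨?_, ?_, ?_⟩
    · rcases hσ with rfl | rfl <;> simp [ha]
    · rcases hτ with rfl | rfl <;> simp [hη]
    · rcases hτ with rfl | rfl <;> simp [Real.dist_eq, abs_of_pos hη, hηδ]
  refine Γ.not_isInner_of_convex (C := {p : Pt | σ * p.1 ≤ σ * (Γ.pos v).1} ∩
    ({p : Pt | τ * p.2 < τ * (Γ.pos v).2} ∩ {p | p.2 ∈ Metric.ball (Γ.pos v).2 δ})) ?_ ?_ ?_ ?_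
  · refine (convex_halfSpace_le (f := fun p : Pt => σ * p.1)
      ⟨fun x y => by simp [mul_add], fun c x => by simp; ring⟩ _).inter
      ((convex_halfSpace_lt (f := fun p : Pt => τ * p.2)
      ⟨fun x y => by simp [mul_add], fun c x => by simp; ring⟩ _).inter ?_)
    exact (convex_ball (Γ.pos v).2 δ).linear_preimage (LinearMap.snd ℝ ℝ ℝ)
  · intro hb
    obtain ⟨r, hr⟩ := hb.subset_closedBall (Γ.pos v)
    have h2 : |(Γ.pos v).1 - σ * (|r| + 1) - (Γ.pos v).1| ≤ r := (le_max_left _ _).trans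
      (Metric.mem_closedBall.1 (hr (hCmem (|r| + 1) (δ / 2) (by positivity) (by positivity)
        (by linarith))))
    have habs : |σ| = 1 := by rcases hσ with rfl | rfl <;> simp
    rw [sub_sub_cancel_left, abs_neg, abs_mul, habs, one_mul, abs_of_pos (by positivity)] at h2
    linarith [le_abs_self r]
  · rw [disjoint_left]
    rintro p ⟨hp1, hp2, hp3⟩ himg
    have hp2 : τ * p.2 < τ * (Γ.pos v).2 := hp2
    rcases mem_image himg with ⟨z, rfl⟩ | ⟨e, he, hpe⟩
    · by_cases hz : z = v
      · exact (hz ▸ hp2).ne rfl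
      · exact hCK _ hp1 hp3 (Or.inr ⟨z, hz, rfl⟩)
    · by_cases hve : v ∈ e
      · obtain ⟨w, rfl⟩ := hve
        have hw := hup w he
        rcases hτ with rfl | rfl <;> rcases mem_uIcc.1 (hmono.snd_mem_uIcc he hpe) with h | h <;>
          linarith [h.1, h.2]
      · refine hCK _ hp1 hp3 (Or.inl ?_)
        simp only [mem_iUnion, exists_prop]
        exact ⟨e, ⟨he, hve⟩, hpe⟩
  · rw [Metric.mem_closure_iff]
    intro ε hε
    refine ⟨_, hCmem 0 (min δ ε / 2) le_rfl (by positivity)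
      (by linarith [min_le_left δ ε]), ?_⟩
    have h1 : 0 < min δ ε := lt_min hδ hε
    have h2 := min_le_right δ ε
    rw [Prod.dist_eq]
    rcases hτ with rfl | rfl <;> simp [abs_of_pos h1, hε] <;> linarith

/-- Every inner vertex has a neighbour weakly below it (`τ = 1`) and weakly above it (`τ = -1`). -/
lemma exists_neighbour [Fintype V] (hG : IsTriangulated G) (hpl : Γ.IsPlanar)
    (hmono : Γ.IsYMonotone) {v : V} (hv : Γ.IsInner v) :
    (∃ w, G.Adj v w ∧ (Γ.pos w).2 ≤ (Γ.pos v).2) ∧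
      ∃ w, G.Adj v w ∧ (Γ.pos v).2 ≤ (Γ.pos w).2 := by
  obtain ⟨hcard, hE, -⟩ := hG
  have one : (1 : ℝ) = 1 ∨ (1 : ℝ) = -1 := Or.inl rfl
  have mone : (-1 : ℝ) = 1 ∨ (-1 : ℝ) = -1 := Or.inr rfl
  set R := Γ.toRowDrawing hpl hmono with hR
  have neg_snd : ∀ {e : Sym2 V} {b : ℝ}, (b, (Γ.pos v).2) ∈ Γ.edgePts e →
      -b ∈ R.flipX.S e (Γ.pos v).2 := by
    intro e b hb
    change - -b ∈ rowSlice _ _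
    rwa [neg_neg]
  have one_le : ∀ {a b : ℝ}, a ≤ b → 1 * a ≤ 1 * b := by simp
  have mone_le : ∀ {a b : ℝ}, -a ≤ -b → -1 * a ≤ -1 * b := by simp
  constructor
  · by_contra! hup
    have hup' : ∀ w, G.Adj v w → (1 : ℝ) * (Γ.pos v).2 < 1 * (Γ.pos w).2 := by
      simpa only [one_mul] using hup
    have := R.card_edges_lt (v := v) hup
      (fun h => not_isInner_of_visible hpl hmono one one hup'
        (fun z hz => one_le (h.1 z hz)) (fun e he hve b hb => one_le (h.2 e he hve b hb)) hv)
      (fun h => not_isInner_of_visible hpl hmono mone one hup'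
        (fun z hz => mone_le (h.1 z hz))
        (fun e he hve b hb => mone_le (h.2 e he hve (-b) (neg_snd hb))) hv)
      (by
        by_contra! hlow
        exact not_isInner_of_extreme hmono one (fun z => one_le (hlow z)) hv)
    omega
  · by_contra! hup
    have hup' : ∀ w, G.Adj v w → (-1 : ℝ) * (Γ.pos v).2 < -1 * (Γ.pos w).2 := by
      simpa only [neg_mul, one_mul, neg_lt_neg_iff] using hup
    have := R.flipY.card_edges_lt (v := v) (fun w hw => neg_lt_neg (hup w hw))
      (fun h => not_isInner_of_visible hpl hmono one mone hup'
        (fun z hz => one_le (((R.flipY_leftVis v).1 h).1 z hz))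
        (fun e he hve b hb => one_le (((R.flipY_leftVis v).1 h).2 e he hve b hb)) hv)
      (fun h => not_isInner_of_visible hpl hmono mone mone hup'
        (fun z hz => mone_le (h.1 z (congrArg Neg.neg hz)))
        (fun e he hve b hb => mone_le (h.2 e he hve (-b) (by
          change - -b ∈ rowSlice _ (- -(Γ.pos v).2)
          rwa [neg_neg, neg_neg]))) hv)
      (by
        by_contra! hlow
        exact not_isInner_of_extreme hmono mone (fun z => mone_le (hlow z)) hv)
    omega

end PolyDrawing

/-- In a planar `y`-monotone poly-line drawing of a triangulated
graph, every inner vertex has `indeg ≥ 1` and `outdeg ≥ 1`; equivalently, it has a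
neighbour weakly below and a neighbour weakly above. -/
theorem stmt2 {V : Type} [Fintype V] (G : SimpleGraph V) (hG : IsTriangulated G)
    (Γ : PolyDrawing G) (hpl : Γ.IsPlanar) (hmono : Γ.IsYMonotone) :
    ∀ v : V, Γ.IsInner v →
      (1 ≤ Γ.indeg v ∧ 1 ≤ Γ.outdeg v) ∧
      (∃ w : V, G.Adj v w ∧ (Γ.pos w).2 ≤ (Γ.pos v).2) ∧
      (∃ w' : V, G.Adj v w' ∧ (Γ.pos v).2 ≤ (Γ.pos w').2) := by
  intro v hv
  obtain ⟨h1, h2⟩ := PolyDrawing.exists_neighbour hG hpl hmono hv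
  exact ⟨⟨(Set.ncard_pos (Set.toFinite _)).2 h1, (Set.ncard_pos (Set.toFinite _)).2 h2⟩, h1, h2⟩
end
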